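/- Let x, x', y, y' be dominant elements of W with [x,y] and [x',y'] full intervals, and let φ : [x,y] → [x',y'] be an isomorphism of posets. (1) If ℓ(x, z_i(x)) ≥ 4 for both i = 1, 2, then φ({z_1(x), z_2(x)}) = {z_1(x'), z_2(x')}. (2) If ℓ(z_i(y), y) ≥ 4 for both i = 1, 2, then φ({z_1(y), z_2(y)}) = {z_1(y'), z_2(y')}. (Here z_i(x'), z_i(y') are defined with respect to the interval [x',y'] in the same way as z_i(x), z_i(y) are defined with respect to [x,y].) -/

import Mathlib

noncomputable section

open scoped RealInnerProductSpace

/-- The Bruhat strict order on a Coxeter group: the transitive closure of the relation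
"multiply on the left by a reflection, increasing the length". -/
def bruhatLT {B : Type*} {W : Type*} [Group W] {M : CoxeterMatrix B}
    (cs : CoxeterSystem M W) : W → W → Prop :=
  Relation.TransGen (fun a b => (∃ t, cs.IsReflection t ∧ b = t * a) ∧ cs.length a < cs.length b)

/-- The Bruhat order on a Coxeter group. -/
def bruhatLE {B : Type*} {W : Type*} [Group W] {M : CoxeterMatrix B}
    (cs : CoxeterSystem M W) (x y : W) : Prop :=
  x = y ∨ bruhatLT cs x y

/-- The Bruhat interval `[x, y]` as a set. -/
def Iset {B : Type*} {W : Type*} [Group W] {M : CoxeterMatrix B}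
    (cs : CoxeterSystem M W) (x y : W) : Set W :=
  {z | bruhatLE cs x z ∧ bruhatLE cs z y}

/-- The Bruhat covers `U(x)` of an element `x`. -/
def Uset {B : Type*} {W : Type*} [Group W] {M : CoxeterMatrix B}
    (cs : CoxeterSystem M W) (x : W) : Set W :=
  {w | bruhatLT cs x w ∧ cs.length w = cs.length x + 1}

/-- The Bruhat cocovers `L(y)` of an element `y`. -/
def Lset {B : Type*} {W : Type*} [Group W] {M : CoxeterMatrix B}
    (cs : CoxeterSystem M W) (y : W) : Set W :=
  {w | bruhatLT cs w y ∧ cs.length y = cs.length w + 1}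

/-- An interval `[x, y]` is full if it contains all Bruhat covers of `x` and all
Bruhat cocovers of `y`. -/
def FullInt {B : Type*} {W : Type*} [Group W] {M : CoxeterMatrix B}
    (cs : CoxeterSystem M W) (x y : W) : Prop :=
  Uset cs x ⊆ Iset cs x y ∧ Lset cs y ⊆ Iset cs x y

/-- Two Bruhat intervals (possibly in different Coxeter groups) are isomorphic as posets. -/
def IntervalIso {B : Type*} {W : Type*} {B' : Type*} {W' : Type*} [Group W] [Group W']
    {M : CoxeterMatrix B} {M' : CoxeterMatrix B'}
    (cs : CoxeterSystem M W) (cs' : CoxeterSystem M' W') (x y : W) (x' y' : W') : Prop :=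
  ∃ f : {z : W // bruhatLE cs x z ∧ bruhatLE cs z y} ≃
        {z : W' // bruhatLE cs' x' z ∧ bruhatLE cs' z y'},
    ∀ u v, bruhatLE cs u.1 v.1 ↔ bruhatLE cs' (f u).1 (f v).1

/-- The group `G` of generic automorphisms: the subgroup of the permutation group of `W`
generated by the Dynkin diagram automorphisms `δ`, `σ` and inversion. -/
def Gsub {W : Type*} [Group W] (dl sg : W ≃* W) : Subgroup (Equiv.Perm W) :=
  Subgroup.closure {dl.toEquiv, sg.toEquiv, Equiv.inv W}

/-- The Euclidean plane, with coordinates taken in the basis of simple roots of `A₂`. -/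
abbrev E2 : Type := ℝ × ℝ

/-- The `A₂` inner product on the plane, in which `(αᵢ, αᵢ) = 2` and `(α₁, α₂) = -1`. -/
def B2 (u v : E2) : ℝ := 2*u.1*v.1 - u.1*v.2 - u.2*v.1 + 2*u.2*v.2

/-- The simple root `α₁`. -/
def a1 : E2 := (1, 0)
/-- The simple root `α₂`. -/
def a2 : E2 := (0, 1)
/-- The fundamental weight `ϖ₁`, satisfying `(αᵢ, ϖⱼ) = δᵢⱼ`. -/
def fw1 : E2 := (2/3, 1/3)
/-- The fundamental weight `ϖ₂`. -/
def fw2 : E2 := (1/3, 2/3)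
/-- `ρ = ϖ₁ + ϖ₂ = α₁ + α₂`. -/
def rho2 : E2 := (1, 1)

/-- The affine reflection `s_{α,k}` of the plane in the line `{v | (α, v) = k}`,
for a root `α` with `(α, α) = 2`. -/
def reflE (a : E2) (k : ℝ) (v : E2) : E2 := v - (B2 a v - k) • a

/-- The barycenter of the alcove of `z`, i.e. the image under the affine action of `z` of
the barycenter `-ρ/3` of the fundamental alcove (whose vertices are `0, -ϖ₁, -ϖ₂`). -/
def cen {W : Type*} [Group W] (act : W →* Equiv.Perm E2) (z : W) : E2 :=
  act z ((-(1/3 : ℝ)) • rho2)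

/-- The weight lattice `Λ = ℤϖ₁ ⊕ ℤϖ₂`. -/
def wLat : Set E2 := {v | ∃ a b : ℤ, v = (a : ℝ) • fw1 + (b : ℝ) • fw2}

/-- The fundamental alcove `A₊`. -/
def AlcoveFund : Set E2 :=
  {v | (-1 < B2 a1 v ∧ B2 a1 v < 0) ∧ (-1 < B2 a2 v ∧ B2 a2 v < 0) ∧
    (-1 < B2 rho2 v ∧ B2 rho2 v < 0)}

/-- The zone `F_id` of the plane. -/
def Fid : Set E2 := {v | -1 ≤ B2 a1 v ∧ -1 ≤ B2 a2 v ∧ -1 ≤ B2 rho2 v}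

/-- The cone `K` of nonnegative combinations of the simple roots. -/
def coneK : Set E2 := {v | ∃ a b : ℝ, 0 ≤ a ∧ 0 ≤ b ∧ v = a • a1 + b • a2}

/-- The set `D` of dominant elements, given functions `θ, θˢ` enumerating them. -/
def Dset {W : Type*} (th ths : ℕ → ℕ → W) : Set W :=
  {w | (∃ m n, w = th m n) ∨ (∃ m n, w = ths m n)}

/-- The polygon `Pgn_{x,y} = F_id ∩ (cen x + K) ∩ (cen y - K)`. -/
def Pgn {W : Type*} [Group W] (act : W →* Equiv.Perm E2) (x y : W) : Set E2 :=
  {v ∈ Fid | (∃ k ∈ coneK, v = cen act x + k) ∧ (∃ k ∈ coneK, v = cen act y - k)}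

/-- The element `x_k`: the product of the first `k` terms of `s₁, s₂, s₀, s₁, s₂, s₀, …`. -/
def xelt {W : Type*} [Group W] {M : CoxeterMatrix (Fin 3)} (cs : CoxeterSystem M W)
    (k : ℕ) : W :=
  ((List.range k).map (fun j => cs.simple (⟨(j + 1) % 3, Nat.mod_lt _ (by norm_num)⟩ : Fin 3))).prod

/-- `zoneOf cs w v` says that `w` is one of the six elements of `W_f` and `v` lies in the
corresponding zone `F_w` of the plane. -/
def zoneOf {W : Type*} [Group W] {M : CoxeterMatrix (Fin 3)} (cs : CoxeterSystem M W)
    (w : W) (v : E2) : Prop :=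
  (w = 1 ∧ v ∈ Fid) ∨
  (w = cs.simple 1 ∧ B2 a1 v ≤ -1 ∧ -1 ≤ B2 rho2 v) ∨
  (w = cs.simple 2 ∧ B2 a2 v ≤ -1 ∧ -1 ≤ B2 rho2 v) ∨
  (w = cs.simple 1 * cs.simple 2 ∧ B2 rho2 v ≤ -1 ∧ 0 ≤ B2 a2 v) ∨
  (w = cs.simple 2 * cs.simple 1 ∧ B2 rho2 v ≤ -1 ∧ 0 ≤ B2 a1 v) ∨
  (w = cs.simple 1 * cs.simple 2 * cs.simple 1 ∧ B2 a1 v ≤ 0 ∧ B2 a2 v ≤ 0)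

/-- Thickness of the interval `[x,y]`: `x + 2αᵢ` and `y - 2αᵢ` belong to `[x,y]` and their
barycenters lie in `F_id`, for `i = 1, 2`. -/
def Thick {W : Type*} [Group W] {M : CoxeterMatrix (Fin 3)} (cs : CoxeterSystem M W)
    (act : W →* Equiv.Perm E2) (Wadd : W → E2 → W) (x y : W) : Prop :=
  Wadd x ((2 : ℝ) • a1) ∈ Iset cs x y ∧ Wadd x ((2 : ℝ) • a2) ∈ Iset cs x y ∧
  Wadd y (-((2 : ℝ) • a1)) ∈ Iset cs x y ∧ Wadd y (-((2 : ℝ) • a2)) ∈ Iset cs x y ∧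
  cen act (Wadd x ((2 : ℝ) • a1)) ∈ Fid ∧ cen act (Wadd x ((2 : ℝ) • a2)) ∈ Fid ∧
  cen act (Wadd y (-((2 : ℝ) • a1))) ∈ Fid ∧ cen act (Wadd y (-((2 : ℝ) • a2))) ∈ Fid

/-- The vertex `vᵢ(x)` of `Pgn_{x,y}` adjacent to `cen x` in the direction of the simple
root `α`. -/
def vXpt {W : Type*} [Group W] (act : W →* Equiv.Perm E2) (x y : W) (al : E2) : E2 :=
  cen act x + sSup {t : ℝ | 0 ≤ t ∧ cen act x + t • al ∈ Pgn act x y} • al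

/-- The vertex `vᵢ(y)` of `Pgn_{x,y}` adjacent to `cen y` in the direction `-α`. -/
def vYpt {W : Type*} [Group W] (act : W →* Equiv.Perm E2) (x y : W) (al : E2) : E2 :=
  cen act y - sSup {t : ℝ | 0 ≤ t ∧ cen act y - t • al ∈ Pgn act x y} • al

/-- `z` is the element `zᵢ(x)`: its barycenter lies on the segment from `cen x` to `vᵢ(x)`
and its closed alcove contains `vᵢ(x)`. -/
def IsZx {W : Type*} [Group W] (act : W →* Equiv.Perm E2) (x y z : W) (al : E2) : Prop :=
  cen act z ∈ segment ℝ (cen act x) (vXpt act x y al) ∧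
    vXpt act x y al ∈ closure (⇑(act z) '' AlcoveFund)

/-- `z` is the element `zᵢ(y)`: its barycenter lies on the segment from `vᵢ(y)` to `cen y`
and its closed alcove contains `vᵢ(y)`. -/
def IsZy {W : Type*} [Group W] (act : W →* Equiv.Perm E2) (x y z : W) (al : E2) : Prop :=
  cen act z ∈ segment ℝ (vYpt act x y al) (cen act y) ∧
    vYpt act x y al ∈ closure (⇑(act z) '' AlcoveFund)

/-- An alcove of the affine `A₂` arrangement: the roots `α₁`, `α₂`, `ρ` take values in
`(a - 1, a)`, `(b - 1, b)`, `(c - 1, c)` on it, where `c = a + b - e`. -/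
@[ext] structure Alc where
  a : ℤ
  b : ℤ
  e : ℤ
  he : e = 0 ∨ e = 1

namespace Alc

/-- Three times the first coordinate of the barycenter. -/
def X (u : Alc) : ℤ := 2 * u.a + u.b - 1 - u.e
/-- Three times the second coordinate of the barycenter. -/
def Y (u : Alc) : ℤ := u.a + 2 * u.b - 1 - u.e
/-- The integer `c` such that `c - 1 < (ρ, v) < c` on the alcove. -/
def c (u : Alc) : ℤ := u.a + u.b - u.e

/-- The number of hyperplanes separating the alcove from the fundamental one. -/
def len (u : Alc) : ℕ := u.a.natAbs + u.b.natAbs + u.c.natAbs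

/-- `v` is the reflection of `u` in some hyperplane orthogonal to `α₁`. -/
def Refl1 (u v : Alc) : Prop := v.e = 1 - u.e ∧ u.Y = v.Y
/-- `v` is the reflection of `u` in some hyperplane orthogonal to `α₂`. -/
def Refl2 (u v : Alc) : Prop := v.e = 1 - u.e ∧ u.X = v.X
/-- `v` is the reflection of `u` in some hyperplane orthogonal to `ρ`. -/
def Refl3 (u v : Alc) : Prop := v.e = 1 - u.e ∧ u.X - u.Y = v.X - v.Y
/-- `v` is the image of `u` under an affine reflection. -/
def Refl (u v : Alc) : Prop := Refl1 u v ∨ Refl2 u v ∨ Refl3 u v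

/-- The left action of the simple reflections on alcoves. -/
def sr (i : Fin 3) (u : Alc) : Alc :=
  match i with
  | 0 => ⟨-u.b, -u.a, 1 - u.e, by have := u.he; omega⟩
  | 1 => ⟨1 - u.a, u.c, 1 - u.e, by have := u.he; omega⟩
  | 2 => ⟨u.c, 1 - u.b, 1 - u.e, by have := u.he; omega⟩

/-- Reflection increasing the length. -/
def Edge (u v : Alc) : Prop := Refl u v ∧ u.len < v.len
/-- Reflection increasing the length by one. -/
def Cov (u v : Alc) : Prop := Refl u v ∧ v.len = u.len + 1
/-- The Bruhat order on alcoves. -/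
def Le (u v : Alc) : Prop := Relation.ReflTransGen Edge u v

theorem len_lt_iff_of_refl1 {u v : Alc} (h : Refl1 u v) :
    u.len < v.len ↔ (0 < u.a + v.a ∧ u.a < v.a) ∨ (u.a + v.a ≤ 0 ∧ v.a < u.a) := by
  obtain ⟨h1, h2⟩ := h
  have := u.he
  simp only [len, c, Y] at *
  lia

theorem len_lt_iff_of_refl2 {u v : Alc} (h : Refl2 u v) :
    u.len < v.len ↔ (0 < u.b + v.b ∧ u.b < v.b) ∨ (u.b + v.b ≤ 0 ∧ v.b < u.b) := by
  obtain ⟨h1, h2⟩ := h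
  have := u.he
  simp only [len, c, X] at *
  lia

theorem len_lt_iff_of_refl3 {u v : Alc} (h : Refl3 u v) :
    u.len < v.len ↔ (0 < u.c + v.c ∧ u.c < v.c) ∨ (u.c + v.c ≤ 0 ∧ v.c < u.c) := by
  obtain ⟨h1, h2⟩ := h
  have := u.he
  simp only [len, c, X, Y] at *
  lia

theorem ext' {u v : Alc} (hX : u.X = v.X) (hY : u.Y = v.Y) : u = v := by
  have := u.he
  have := v.he
  simp only [X, Y] at hX hY
  ext <;> omega

theorem sr_sr (i : Fin 3) (u : Alc) : sr i (sr i u) = u := by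
  match i with
  | 0 => ext <;> simp only [sr] <;> omega
  | 1 => ext <;> simp only [sr, c] <;> omega
  | 2 => ext <;> simp only [sr, c] <;> omega

theorem refl_symm {u v : Alc} (h : Refl u v) : Refl v u := by
  simp only [Refl, Refl1, Refl2, Refl3] at *; omega

theorem refl_sr (i : Fin 3) (u : Alc) : Refl u (sr i u) := by
  have := u.he
  match i with
  | 0 => refine Or.inr (Or.inr ⟨rfl, ?_⟩); simp only [sr, X, Y]; omega
  | 1 => refine Or.inl ⟨rfl, ?_⟩; simp only [sr, Y, c]; omega
  | 2 => refine Or.inr (Or.inl ⟨rfl, ?_⟩); simp only [sr, X, c]; omega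

theorem refl_sr_sr (i : Fin 3) {u v : Alc} (h : Refl u v) : Refl (sr i u) (sr i v) := by
  have := u.he
  have := v.he
  fin_cases i <;> simp only [Refl, Refl1, Refl2, Refl3, sr, c, X, Y] at * <;> omega

theorem len_sr (i : Fin 3) (u : Alc) :
    (sr i u).len = u.len + 1 ∨ u.len = (sr i u).len + 1 := by
  have := u.he
  fin_cases i <;> simp only [sr, len, c] <;> omega

theorem len_sr_one_lt {u : Alc} (h : 0 < u.a) : (sr 1 u).len < u.len := by
  have := u.he
  simp only [sr, len, c]; omega

theorem len_sr_two_lt {u : Alc} (h : 0 < u.b) : (sr 2 u).len < u.len := by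
  have := u.he
  simp only [sr, len, c]; omega

theorem len_sr_zero_lt {u : Alc} (h : u.c < 0) : (sr 0 u).len < u.len := by
  have := u.he
  simp only [sr, len, c] at *; omega

theorem exists_len_sr_lt {u : Alc} (h : u.len ≠ 0) : ∃ i, (sr i u).len < u.len := by
  by_cases ha : 0 < u.a
  · exact ⟨1, len_sr_one_lt ha⟩
  by_cases hb : 0 < u.b
  · exact ⟨2, len_sr_two_lt hb⟩
  refine ⟨0, len_sr_zero_lt ?_⟩
  have := u.he
  simp only [len, c] at *; omega

/-- A simple reflection preserves an edge of the Bruhat graph, unless it swaps its ends. -/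
theorem edge_sr (i : Fin 3) {u v : Alc} (h : Edge u v) :
    v = sr i u ∨ Edge (sr i u) (sr i v) := by
  obtain ⟨h, hl⟩ := h
  have hu := u.he
  have hv := v.he
  rw [or_iff_not_imp_left]
  intro hne
  refine ⟨refl_sr_sr i h, ?_⟩
  rw [Alc.ext_iff] at hne
  rcases h with h | h | h
  · rw [len_lt_iff_of_refl1 h] at hl
    obtain ⟨h1, h2⟩ := h
    fin_cases i
    · rw [len_lt_iff_of_refl2 (by simp only [Refl2, sr, X, Y, c] at *; omega)]
      simp only [sr, c, X, Y] at *; omega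
    · rw [len_lt_iff_of_refl1 (by simp only [Refl1, sr, X, Y, c] at *; omega)]
      simp only [sr, c, X, Y] at *; omega
    · rw [len_lt_iff_of_refl3 (by simp only [Refl3, sr, X, Y, c] at *; omega)]
      simp only [sr, c, X, Y] at *; omega
  · rw [len_lt_iff_of_refl2 h] at hl
    obtain ⟨h1, h2⟩ := h
    fin_cases i
    · rw [len_lt_iff_of_refl1 (by simp only [Refl1, sr, X, Y, c] at *; omega)]
      simp only [sr, c, X, Y] at *; omega
    · rw [len_lt_iff_of_refl3 (by simp only [Refl3, sr, X, Y, c] at *; omega)]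
      simp only [sr, c, X, Y] at *; omega
    · rw [len_lt_iff_of_refl2 (by simp only [Refl2, sr, X, Y, c] at *; omega)]
      simp only [sr, c, X, Y] at *; omega
  · rw [len_lt_iff_of_refl3 h] at hl
    obtain ⟨h1, h2⟩ := h
    fin_cases i
    · rw [len_lt_iff_of_refl3 (by simp only [Refl3, sr, X, Y, c] at *; omega)]
      simp only [sr, c, X, Y] at *; omega
    · rw [len_lt_iff_of_refl2 (by simp only [Refl2, sr, X, Y, c] at *; omega)]
      simp only [sr, c, X, Y] at *; omega
    · rw [len_lt_iff_of_refl1 (by simp only [Refl1, sr, X, Y, c] at *; omega)]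
      simp only [sr, c, X, Y] at *; omega

theorem edge_sr_of_lt {i : Fin 3} {u : Alc} (h : u.len < (sr i u).len) : Edge u (sr i u) :=
  ⟨refl_sr i u, h⟩

theorem edge_sr_of_gt {i : Fin 3} {u : Alc} (h : (sr i u).len < u.len) : Edge (sr i u) u :=
  ⟨refl_symm (refl_sr i u), h⟩

theorem len_le_of_le {u v : Alc} (h : Le u v) : u.len ≤ v.len := by
  induction h with
  | refl => exact le_rfl
  | tail _ h ih => exact ih.trans h.2.le

theorem eq_of_le_of_len_le {u v : Alc} (h : Le u v) (hl : v.len ≤ u.len) : u = v := by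
  rcases Relation.ReflTransGen.cases_head h with h | ⟨w, hw, h⟩
  · exact h
  · have := len_le_of_le h
    have := hw.2
    omega

theorem Le.trans {u v w : Alc} (h : Le u v) (h' : Le v w) : Le u w :=
  Relation.ReflTransGen.trans h h'

/-- The lifting property. -/
theorem le_lift (i : Fin 3) {u v : Alc} (h : Le u v) :
    Le (sr i u) (sr i v) ∨ (Le (sr i u) v ∧ Le u (sr i v)) := by
  induction h with
  | refl => exact Or.inl .refl
  | @tail v w h hvw ih =>
    rcases edge_sr i hvw with rfl | he
    · rw [sr_sr]
      rcases ih with ih | ih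
      · exact Or.inr ⟨ih, h⟩
      · exact Or.inl ih.1
    · rcases ih with ih | ih
      · exact Or.inl (ih.tail he)
      · exact Or.inr ⟨ih.1.tail hvw, ih.2.tail he⟩

theorem le_sr_of_le {i : Fin 3} {u v : Alc} (h : Le u v) (hv : (sr i v).len < v.len)
    (hu : u.len < (sr i u).len) : Le u (sr i v) ∧ Le (sr i u) v := by
  rcases le_lift i h with h' | h'
  · exact ⟨.head (edge_sr_of_lt hu) h', h'.tail (edge_sr_of_gt hv)⟩
  · exact h'.symm

theorem sr_le_sr_of_le {i : Fin 3} {u v : Alc} (h : Le u v) (hv : (sr i v).len < v.len)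
    (hu : (sr i u).len < u.len) : Le (sr i u) (sr i v) := by
  rcases le_lift i h with h' | h'
  · exact h'
  · exact .head (edge_sr_of_gt hu) h'.2

/-- Chains of Bruhat covers. -/
def CLe (u v : Alc) : Prop := Relation.ReflTransGen Cov u v

theorem edge_of_cov {u v : Alc} (h : Cov u v) : Edge u v := ⟨h.1, by have := h.2; omega⟩

theorem le_of_cle {u v : Alc} (h : CLe u v) : Le u v :=
  Relation.ReflTransGen.mono (fun _ _ h => edge_of_cov h) _ _ h

theorem cov_sr_of_lt {i : Fin 3} {u : Alc} (h : u.len < (sr i u).len) : Cov u (sr i u) :=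
  ⟨refl_sr i u, by rcases len_sr i u with h' | h' <;> omega⟩

theorem cov_sr_of_gt {i : Fin 3} {u : Alc} (h : (sr i u).len < u.len) : Cov (sr i u) u :=
  ⟨refl_symm (refl_sr i u), by rcases len_sr i u with h' | h' <;> omega⟩

theorem cle_sr {i : Fin 3} {u v : Alc} (h : CLe u v) (hu : u.len < (sr i u).len) :
    (CLe (sr i u) (sr i v) ∧ v.len < (sr i v).len) ∨ CLe (sr i u) v := by
  induction h with
  | refl => exact Or.inl ⟨.refl, hu⟩
  | @tail v w h hvw ih =>
    rcases ih with ⟨ih, hv⟩ | ih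
    · rcases edge_sr i (edge_of_cov hvw) with rfl | he
      · exact Or.inr ih
      · have h1 := he.2
        have h2 := hvw.2
        rcases len_sr i w with h3 | h3
        · refine Or.inl ⟨ih.tail ⟨he.1, ?_⟩, by omega⟩
          rcases len_sr i v with h4 | h4 <;> omega
        · rcases len_sr i v with h4 | h4 <;> omega
    · exact Or.inr (ih.tail hvw)

theorem cle_of_le {u v : Alc} (h : Le u v) : CLe u v := by
  obtain ⟨n, hn⟩ : ∃ n, v.len = n := ⟨_, rfl⟩
  induction n generalizing u v with
  | zero =>
    rw [eq_of_le_of_len_le h (by omega)]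
    exact .refl
  | succ n ih =>
    obtain ⟨i, hi⟩ := exists_len_sr_lt (u := v) (by omega)
    have hl : (sr i v).len = n := by rcases len_sr i v with h' | h' <;> omega
    by_cases hu : u.len < (sr i u).len
    · exact (ih (le_sr_of_le h hi hu).1 hl).tail (cov_sr_of_gt hi)
    · have hu' : (sr i u).len < u.len := by rcases len_sr i u with h' | h' <;> omega
      have := cle_sr (i := i) (ih (sr_le_sr_of_le h hi hu') hl) (by rwa [sr_sr])
      rw [sr_sr, sr_sr] at this
      rcases this with h' | h'
      · exact h'.1
      · exact h'.tail (cov_sr_of_gt hi)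

theorem exists_cov_of_le {u v : Alc} (h : Le u v) (hne : u ≠ v) : ∃ w, Cov u w ∧ Le w v := by
  rcases Relation.ReflTransGen.cases_head (cle_of_le h) with h | ⟨w, hw, h⟩
  · exact absurd h hne
  · exact ⟨w, hw, le_of_cle h⟩

theorem cov_of_le {u v : Alc} (h : Le u v) (hl : v.len = u.len + 1) : Cov u v := by
  obtain ⟨w, hw, h'⟩ := exists_cov_of_le h (by rintro rfl; omega)
  have := hw.2
  rwa [← eq_of_le_of_len_le h' (by omega)]

/-- An interval of length two has at least two elements in the middle. -/
theorem exists_ne_cov_cov {u v : Alc} (h : Le u v) (hl : v.len = u.len + 2) :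
    ∃ m m', m ≠ m' ∧ Cov u m ∧ Cov m v ∧ Cov u m' ∧ Cov m' v := by
  obtain ⟨n, hn⟩ : ∃ n, v.len = n := ⟨_, rfl⟩
  induction n generalizing u v with
  | zero => omega
  | succ n ih =>
    obtain ⟨i, hi⟩ := exists_len_sr_lt (u := v) (by omega)
    have hv : v.len = (sr i v).len + 1 := by rcases len_sr i v with h' | h' <;> omega
    rcases len_sr i u with hu | hu
    · obtain ⟨h1, h2⟩ := le_sr_of_le h hi (by omega)
      refine ⟨sr i u, sr i v, ?_, cov_sr_of_lt (by omega), cov_of_le h2 (by omega),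
        cov_of_le h1 (by omega), cov_sr_of_gt hi⟩
      intro heq
      have := congrArg (sr i) heq
      rw [sr_sr, sr_sr] at this
      rw [this] at hl; omega
    · have h1 := sr_le_sr_of_le h hi (by omega)
      obtain ⟨m, m', hne, hm1, hm2, hm1', hm2'⟩ := ih h1 (by omega) (by omega)
      have key : ∀ m, Cov (sr i u) m → Cov m (sr i v) →
          (m = u ∧ Cov u (sr i v)) ∨ (Cov u (sr i m) ∧ Cov (sr i m) v) := by
        intro m hm1 hm2
        rcases edge_sr i (edge_of_cov hm1) with hm | he
        · rw [sr_sr] at hm; subst hm; exact Or.inl ⟨rfl, hm2⟩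
        · rw [sr_sr] at he
          have a1 := he.2
          have a2 := hm1.2
          have a3 : (sr i m).len = m.len + 1 := by rcases len_sr i m with h' | h' <;> omega
          refine Or.inr ⟨⟨he.1, by omega⟩, ?_⟩
          have := refl_sr_sr i hm2.1
          rw [sr_sr] at this
          have := hm2.2
          exact ⟨by assumption, by omega⟩
      rcases key m hm1 hm2 with ⟨e1, e2⟩ | e
      · rcases key m' hm1' hm2' with ⟨f1, f2⟩ | f
        · exact absurd (e1.trans f1.symm) hne
        · refine ⟨sr i v, sr i m', ?_, e2, cov_sr_of_gt hi, f.1, f.2⟩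
          intro heq
          have := congrArg (sr i) heq
          rw [sr_sr, sr_sr] at this
          have := hm2'.2
          have := congrArg len ‹v = m'›
          omega
      · rcases key m' hm1' hm2' with ⟨f1, f2⟩ | f
        · refine ⟨sr i v, sr i m, ?_, f2, cov_sr_of_gt hi, e.1, e.2⟩
          intro heq
          have := congrArg (sr i) heq
          rw [sr_sr, sr_sr] at this
          have := hm2.2
          have := congrArg len ‹v = m›
          omega
        · refine ⟨sr i m, sr i m', ?_, e.1, e.2, f.1, f.2⟩
          intro heq
          have := congrArg (sr i) heq
          rw [sr_sr, sr_sr] at this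
          exact hne this

/-- The linear function whose level sets are the lines in the `d`-th root direction. -/
def line (d : Fin 3) (u : Alc) : ℤ :=
  match d with
  | 0 => u.Y
  | 1 => u.X
  | 2 => u.X - u.Y

theorem line_eq_of_refl {d : Fin 3} {v v' w : Alc} (h : Refl v w) (h' : Refl v' w)
    (hne : v ≠ v') (hd : line d v = line d v') : line d w = line d v := by
  have hv := v.he
  have hX : v.X ≠ v'.X ∨ v.Y ≠ v'.Y := by
    by_contra! hc
    exact hne (ext' hc.1 hc.2)
  simp only [Refl, Refl1, Refl2, Refl3, X, Y] at h h' hX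
  match d with
  | 0 => simp only [line, X, Y] at *; omega
  | 1 => simp only [line, X, Y] at *; omega
  | 2 => simp only [line, X, Y] at *; omega

theorem exists_three_of_not_line {v v' : Alc} (hd : ∀ d, line d v ≠ line d v') :
    ∃ A B C : ℤ × ℤ, ∀ n, Refl v n → Refl v' n →
      (n.X, n.Y) = A ∨ (n.X, n.Y) = B ∨ (n.X, n.Y) = C := by
  have h0 := hd 0
  have h1 := hd 1
  have h2 := hd 2
  clear hd
  have hv := v.he
  simp only [line] at h0 h1 h2
  have hn3 : ∀ n, Refl v n → n.e = 1 - v.e := fun n hn => by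
    simp only [Refl, Refl1, Refl2, Refl3] at hn; omega
  have hsum : ∀ u : Alc, u.X + u.Y = 3 * (u.a + u.b) - 2 - 2 * u.e := fun u => by
    simp only [X, Y]; ring
  by_cases hc : (v'.X - v.X - 1 + 2 * v.e) % 3 = 0
  · refine ⟨(v'.X, v.Y), (v.X, v.Y + (v'.Y - v.Y) - (v'.X - v.X)),
      (v.X + v'.Y - v.Y, v'.Y), fun n hn hn' => ?_⟩
    have e1 := hn3 n hn
    have s1 := hsum v
    have s2 := hsum v'
    have s3 := hsum n
    simp only [Prod.mk.injEq]
    rcases hn with ⟨-, h⟩ | ⟨-, h⟩ | ⟨-, h⟩ <;> rcases hn' with ⟨e2, h'⟩ | ⟨e2, h'⟩ | ⟨e2, h'⟩ <;>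
      first
      | exact absurd (h.trans h'.symm) ‹_›
      | (clear h0 h1 h2
         first
         | (exfalso; omega)
         | (left; constructor <;> omega)
         | (right; left; constructor <;> omega)
         | (right; right; constructor <;> omega))
  · refine ⟨(v.X, v'.Y), (v.X + (v'.X - v.X) - (v'.Y - v.Y), v.Y),
      (v'.X, v.Y + v'.X - v.X), fun n hn hn' => ?_⟩
    have e1 := hn3 n hn
    have s1 := hsum v
    have s2 := hsum v'
    have s3 := hsum n
    simp only [Prod.mk.injEq]
    rcases hn with ⟨-, h⟩ | ⟨-, h⟩ | ⟨-, h⟩ <;> rcases hn' with ⟨e2, h'⟩ | ⟨e2, h'⟩ | ⟨e2, h'⟩ <;>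
      first
      | exact absurd (h.trans h'.symm) ‹_›
      | (clear h0 h1 h2
         first
         | (exfalso; omega)
         | (left; constructor <;> omega)
         | (right; left; constructor <;> omega)
         | (right; right; constructor <;> omega))

theorem exists_eq_of_refl {v v' : Alc} (hd : ∀ d, line d v ≠ line d v') {n : Fin 4 → Alc}
    (hn : ∀ i, Refl v (n i)) (hn' : ∀ i, Refl v' (n i)) : ¬ Function.Injective n := by
  obtain ⟨A, B, C, h⟩ := exists_three_of_not_line hd
  intro hinj
  have hk : Function.Injective (fun i => ((n i).X, (n i).Y)) := fun i j hij =>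
    hinj (ext' (Prod.mk.inj hij).1 (Prod.mk.inj hij).2)
  have hsub : Finset.univ.image (fun i => ((n i).X, (n i).Y)) ⊆ {A, B, C} := by
    intro p hp
    obtain ⟨i, -, rfl⟩ := Finset.mem_image.1 hp
    simpa using h (n i) (hn i) (hn' i)
  have h1 := Finset.card_le_card hsub
  rw [Finset.card_image_of_injective _ hk] at h1
  have h2 := Finset.card_le_three (a := A) (b := B) (c := C)
  simp at h1
  omega

theorem not_refl_four {v v' n₁ n₂ n₃ n₄ : Alc} (hd : ∀ d, line d v ≠ line d v')
    (h₁ : Refl v n₁ ∧ Refl v' n₁) (h₂ : Refl v n₂ ∧ Refl v' n₂) (h₃ : Refl v n₃ ∧ Refl v' n₃)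
    (h₄ : Refl v n₄ ∧ Refl v' n₄) (h12 : n₁ ≠ n₂) (h13 : n₁ ≠ n₃) (h14 : n₁ ≠ n₄)
    (h23 : n₂ ≠ n₃) (h24 : n₂ ≠ n₄) (h34 : n₃ ≠ n₄) : False := by
  refine exists_eq_of_refl (n := ![n₁, n₂, n₃, n₄]) hd ?_ ?_ ?_
  · intro i; fin_cases i <;> simp [h₁, h₂, h₃, h₄]
  · intro i; fin_cases i <;> simp [h₁, h₂, h₃, h₄]
  · intro i j hij
    fin_cases i <;> fin_cases j <;> simp_all [eq_comm]

/-- A graded relation, contained in the reflection graph, whose intervals of length two have at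
least two elements in the middle. -/
structure CovLike (C : Alc → Alc → Prop) (f : Alc → ℤ) : Prop where
  refl : ∀ {u v}, C u v → Refl u v
  grade : ∀ {u v}, C u v → f v = f u + 1
  diamond : ∀ {u m v}, C u m → C m v → ∃ m', m' ≠ m ∧ C u m' ∧ C m' v

theorem exists_cov_cov_ne {u m v : Alc} (h : Cov u m) (h' : Cov m v) :
    ∃ m', m' ≠ m ∧ Cov u m' ∧ Cov m' v := by
  have h1 := h.2
  have h2 := h'.2
  obtain ⟨n, n', hne, a1, a2, a3, a4⟩ := exists_ne_cov_cov (u := u) (v := v)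
    (.tail (.single (edge_of_cov h)) (edge_of_cov h')) (by omega)
  by_cases hn : n = m
  · exact ⟨n', fun h => hne (hn.trans h.symm), a3, a4⟩
  · exact ⟨n, hn, a1, a2⟩

theorem covLike_cov : CovLike Cov (fun u => u.len) where
  refl h := h.1
  grade h := by have := h.2; push_cast [this]; rfl
  diamond := exists_cov_cov_ne

theorem covLike_flip : CovLike (flip Cov) (fun u => -u.len) where
  refl h := refl_symm h.1
  grade h := by have := h.2; push_cast [this]; ring
  diamond h h' := by
    obtain ⟨m', a, b, c⟩ := exists_cov_cov_ne h' h
    exact ⟨m', a, c, b⟩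

variable {C : Alc → Alc → Prop} {f : Alc → ℤ}

theorem CovLike.mono (hC : CovLike C f) {u v : Alc} (h : Relation.ReflTransGen C u v) :
    f u ≤ f v := by
  induction h with
  | refl => exact le_rfl
  | tail _ h ih => have := hC.grade h; omega

theorem CovLike.line_eq (hC : CovLike C f) {x z w w' : Alc} {d : Fin 3} (hw : C x w)
    (hw' : C x w') (hne : w ≠ w') (hd : line d w = line d w')
    (hat : ∀ c, C x c → Relation.ReflTransGen C c z → c = w ∨ c = w') (n : ℕ) :
    ∀ u, Relation.ReflTransGen C x u → Relation.ReflTransGen C u z → f u - f x ≤ n →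
      line d u = line d x := by
  have hx := line_eq_of_refl (refl_symm (hC.refl hw)) (refl_symm (hC.refl hw')) hne hd
  induction n with
  | zero =>
    intro u hu huz hn
    rcases hu.cases_tail with rfl | ⟨v, hv, hvu⟩
    · rfl
    · have h1 := hC.mono hv
      have h2 := hC.grade hvu
      omega
  | succ n ih =>
    intro u hu huz hn
    rcases hu.cases_tail with rfl | ⟨v, hv, hvu⟩
    · rfl
    have h2 := hC.grade hvu
    rcases hv.cases_tail with rfl | ⟨v₀, hv₀, hv₀v⟩
    · rcases hat u hvu huz with rfl | rfl
      · exact hx.symm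
      · exact hd.symm.trans hx.symm
    · obtain ⟨v', hvv', h3, h4⟩ := hC.diamond hv₀v hvu
      have h5 := hC.grade h4
      have e1 := ih v hv (.head hvu huz) (by push_cast at hn; omega)
      have e2 := ih v' (hv₀.tail h3) (.head h4 huz) (by push_cast at hn; omega)
      rw [line_eq_of_refl (hC.refl h4) (hC.refl hvu) hvv' (e2.trans e1.symm), e2]

theorem CovLike.exists_line (hC : CovLike C f) {x w₁ w₂ w₃ w₄ z : Alc} (h1 : C x w₁)
    (h2 : C w₁ w₂) (h3 : C w₂ w₃) (h4 : C w₃ w₄) (hz : Relation.ReflTransGen C w₄ z)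
    (hat : ∀ c₁ c₂ c₃, C x c₁ → C x c₂ → C x c₃ → Relation.ReflTransGen C c₁ z →
      Relation.ReflTransGen C c₂ z → Relation.ReflTransGen C c₃ z →
      c₁ = c₂ ∨ c₁ = c₃ ∨ c₂ = c₃) :
    ∃ d, ∀ u, Relation.ReflTransGen C x u → Relation.ReflTransGen C u z →
      line d u = line d x := by
  have ne_of_grade : ∀ {u v}, f u ≠ f v → u ≠ v := fun h e => h (congrArg f e)
  have hz3 := Relation.ReflTransGen.head h4 hz
  have hz2 := Relation.ReflTransGen.head h3 hz3
  have hz1 := Relation.ReflTransGen.head h2 hz2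
  obtain ⟨w₁', hne1, h1', h2'⟩ := hC.diamond h1 h2
  have hz1' := Relation.ReflTransGen.head h2' hz2
  have atom : ∀ c, C x c → Relation.ReflTransGen C c z → c = w₁ ∨ c = w₁' := by
    intro c hc hcz
    rcases hat c w₁ w₁' hc h1 h1' hcz hz1 hz1' with h | h | h
    · exact Or.inl h
    · exact Or.inr h
    · exact absurd h.symm hne1
  by_cases hl : ∃ d, line d w₁ = line d w₁'
  · obtain ⟨d, hd⟩ := hl
    exact ⟨d, fun u hu huz => hC.line_eq h1 h1' hne1.symm hd atom (f u - f x).toNat u hu huz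
      (Int.self_le_toNat _)⟩
  exfalso
  push Not at hl
  have rank2 : ∀ a v, C x a → C a v → Relation.ReflTransGen C v z → C w₁ v ∧ C w₁' v := by
    intro a v ha hav hvz
    obtain ⟨a', hne, ha', hav'⟩ := hC.diamond ha hav
    rcases atom a ha (.head hav hvz) with rfl | rfl <;>
      rcases atom a' ha' (.head hav' hvz) with rfl | rfl
    · exact absurd rfl hne
    · exact ⟨hav, hav'⟩
    · exact ⟨hav', hav⟩
    · exact absurd rfl hne
  have g1 := hC.grade h1
  have g1' := hC.grade h1'
  have g2 := hC.grade h2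
  have g3 := hC.grade h3
  obtain ⟨m, hm, hm1, hm2⟩ := hC.diamond h2 h3
  obtain ⟨r, hr, hr1, hr2⟩ := hC.diamond h3 h4
  have gm := hC.grade hm1
  have gr := hC.grade hr1
  have hm1' := (rank2 w₁ m h1 hm1 (.head hm2 hz3)).2
  have hr1' : C m r := by
    obtain ⟨v, hv, hv1, hv2⟩ := hC.diamond h2 hr1
    have gv := hC.grade hv1
    have hv' := rank2 w₁ v h1 hv1 (.head hv2 (.head hr2 hz))
    by_cases hvm : v = m
    · rwa [← hvm]
    · exact (not_refl_four hl (n₁ := x) (n₂ := w₂) (n₃ := m) (n₄ := v)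
        ⟨refl_symm (hC.refl h1), refl_symm (hC.refl h1')⟩ ⟨hC.refl h2, hC.refl h2'⟩
        ⟨hC.refl hm1, hC.refl hm1'⟩ ⟨hC.refl hv'.1, hC.refl hv'.2⟩
        (ne_of_grade (by omega)) (ne_of_grade (by omega)) (ne_of_grade (by omega))
        hm.symm hv.symm (Ne.symm hvm)).elim
  by_cases hd : ∃ d, line d w₂ = line d m
  · obtain ⟨d, hd⟩ := hd
    refine hl d ?_
    rw [line_eq_of_refl (refl_symm (hC.refl h2)) (refl_symm (hC.refl hm1)) hm.symm hd,
      line_eq_of_refl (refl_symm (hC.refl h2')) (refl_symm (hC.refl hm1')) hm.symm hd]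
  · push Not at hd
    exact not_refl_four hd (n₁ := w₁) (n₂ := w₁') (n₃ := w₃) (n₄ := r)
      ⟨refl_symm (hC.refl h2), refl_symm (hC.refl hm1)⟩
      ⟨refl_symm (hC.refl h2'), refl_symm (hC.refl hm1')⟩
      ⟨hC.refl h3, hC.refl hm2⟩ ⟨hC.refl hr1, hC.refl hr1'⟩
      hne1.symm (ne_of_grade (by omega)) (ne_of_grade (by omega))
      (ne_of_grade (by omega)) (ne_of_grade (by omega)) hr.symm

variable {C : Alc → Alc → Prop} {f : Alc → ℤ}

theorem CovLike.induction (hC : CovLike C f) {x z : Alc} {P : Alc → Prop}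
    (base : ∀ w, C x w → Relation.ReflTransGen C w z → P w)
    (step : ∀ v v' u, Relation.ReflTransGen C x v → Relation.ReflTransGen C x v' → C v u →
      C v' u → v ≠ v' → Relation.ReflTransGen C u z → P v → P v' → P u)
    {u : Alc} (hu : Relation.ReflTransGen C x u) (hne : u ≠ x)
    (huz : Relation.ReflTransGen C u z) : P u := by
  obtain ⟨n, hn⟩ : ∃ n : ℕ, f u - f x ≤ n := ⟨_, Int.self_le_toNat _⟩
  induction n generalizing u with
  | zero =>
    rcases hu.cases_tail with rfl | ⟨v, hv, hvu⟩
    · exact absurd rfl hne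
    · have h1 := hC.mono hv
      have h2 := hC.grade hvu
      omega
  | succ n ih =>
    rcases hu.cases_tail with rfl | ⟨v, hv, hvu⟩
    · exact absurd rfl hne
    have h2 := hC.grade hvu
    rcases hv.cases_tail with rfl | ⟨v₀, hv₀, hv₀v⟩
    · exact base u hvu huz
    · obtain ⟨v', hvv', h3, h4⟩ := hC.diamond hv₀v hvu
      have h5 := hC.grade h4
      have h6 := hC.grade hv₀v
      have h7 := hC.mono hv₀
      refine step v v' u hv (hv₀.tail h3) hvu h4 hvv'.symm huz
        (ih hv ?_ (.head hvu huz) ?_) (ih (hv₀.tail h3) ?_ (.head h4 huz) ?_)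
      · rintro rfl; omega
      · push_cast at hn; omega
      · rintro rfl; omega
      · push_cast at hn; omega

/-- The barycenter of the alcove lies in the zone of the identity. -/
def InF (u : Alc) : Prop := 0 ≤ u.a ∧ 0 ≤ u.b ∧ 0 ≤ u.c

/-- The alcove lies in the dominant chamber. -/
def Dom (u : Alc) : Prop := 1 ≤ u.a ∧ 1 ≤ u.b

/-- The reflection in the line `α₁ = -1`. -/
def dn (u : Alc) : Alc := ⟨-1 - u.a, u.c + 1, 1 - u.e, by have := u.he; omega⟩

/-- `u` is, up to the reflection `s₁`, a point of `F_id` on the `α₁`-ray up from `x`. -/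
def OkUp (x u : Alc) : Prop :=
  (InF u ∧ x.X ≤ u.X) ∨ (InF (sr 1 u) ∧ x.X ≤ (sr 1 u).X ∧ (sr 1 u).len = u.len + 1)

/-- `u` is, up to the reflection in `α₁ = -1`, a point of `F_id` on the `α₁`-ray down from `y`. -/
def OkDown (y u : Alc) : Prop :=
  (InF u ∧ u.X ≤ y.X) ∨ (InF (dn u) ∧ (dn u).X ≤ y.X ∧ u.len = (dn u).len + 1)

theorem len_eq_of_inF {u : Alc} (h : InF u) : (u.len : ℤ) = u.a + u.Y + 1 := by
  simp only [InF, c] at h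
  simp only [len, Y, c]
  omega

theorem eq_of_inF {u v : Alc} (hu : InF u) (hv : InF v) (hY : u.Y = v.Y) (he : u.e = v.e)
    (hl : u.len = v.len) : u = v := by
  have h1 := len_eq_of_inF hu
  have h2 := len_eq_of_inF hv
  simp only [Y] at *
  ext <;> omega

theorem okUp_base {x w : Alc} (hx : Dom x) (h : Cov x w) (hY : w.Y = x.Y) : OkUp x w := by
  have he : w.e = 1 - x.e := h.1.elim And.left (Or.rec And.left And.left)
  have hl := h.2
  have := x.he
  simp only [OkUp, InF, Dom, sr, X, Y, len, c] at *
  lia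

theorem okUp_step_aux {x t u : Alc} (h : Cov t u) (hY : u.Y = t.Y)
    (ht : InF (sr 1 t) ∧ x.X ≤ (sr 1 t).X ∧ (sr 1 t).len = t.len + 1) : OkUp x u := by
  have he : u.e = 1 - t.e := h.1.elim And.left (Or.rec And.left And.left)
  have hl := h.2
  have := t.he
  simp only [OkUp, InF, sr, X, Y, len, c] at *
  lia

theorem okUp_step {x v v' u : Alc} (h : Cov v u) (h' : Cov v' u) (hY : u.Y = v.Y)
    (hY' : u.Y = v'.Y) (hne : v ≠ v') (hv : OkUp x v) (hv' : OkUp x v') : OkUp x u := by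
  rcases hv with hv | hv
  · rcases hv' with hv' | hv'
    · refine absurd (eq_of_inF hv.1 hv'.1 (hY.symm.trans hY') ?_ ?_) hne
      · have := h.1.imp And.left (Or.imp And.left And.left)
        have := h'.1.imp And.left (Or.imp And.left And.left)
        omega
      · have := h.2
        have := h'.2
        omega
    · exact okUp_step_aux h' hY' hv'
  · exact okUp_step_aux h hY hv

theorem okDown_base {y w : Alc} (hy : Dom y) (h : Cov w y) (hY : w.Y = y.Y) : OkDown y w := by
  have he : y.e = 1 - w.e := h.1.elim And.left (Or.rec And.left And.left)
  have hl := h.2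
  have := w.he
  simp only [OkDown, InF, Dom, dn, X, Y, len, c] at *
  lia

theorem okDown_step_aux {y t u : Alc} (h : Cov u t) (hY : u.Y = t.Y)
    (ht : InF (dn t) ∧ (dn t).X ≤ y.X ∧ t.len = (dn t).len + 1) : OkDown y u := by
  have he : t.e = 1 - u.e := h.1.elim And.left (Or.rec And.left And.left)
  have hl := h.2
  have := u.he
  simp only [OkDown, InF, dn, X, Y, len, c] at *
  lia

theorem okDown_step {y v v' u : Alc} (h : Cov u v) (h' : Cov u v') (hY : u.Y = v.Y)
    (hY' : u.Y = v'.Y) (hne : v ≠ v') (hv : OkDown y v) (hv' : OkDown y v') : OkDown y u := by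
  rcases hv with hv | hv
  · rcases hv' with hv' | hv'
    · refine absurd (eq_of_inF hv.1 hv'.1 (hY.symm.trans hY') ?_ ?_) hne
      · have := h.1.imp And.left (Or.imp And.left And.left)
        have := h'.1.imp And.left (Or.imp And.left And.left)
        omega
      · have := h.2
        have := h'.2
        omega
    · exact okDown_step_aux h' hY' hv'
  · exact okDown_step_aux h hY hv

/-- The image of an alcove under the diagram automorphism exchanging `α₁` and `α₂`. -/
def swap (u : Alc) : Alc := ⟨u.b, u.a, u.e, u.he⟩

@[simp] theorem swap_swap (u : Alc) : u.swap.swap = u := rfl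

theorem swap_X (u : Alc) : u.swap.X = u.Y := by simp only [swap, X, Y]; ring

theorem swap_Y (u : Alc) : u.swap.Y = u.X := by simp only [swap, X, Y]; ring

theorem swap_len (u : Alc) : u.swap.len = u.len := by simp only [swap, len, c]; omega

theorem refl_swap {u v : Alc} (h : Refl u v) : Refl u.swap v.swap := by
  simp only [Refl, Refl1, Refl2, Refl3, swap_X, swap_Y] at *
  simp only [swap]
  omega

theorem le_swap {u v : Alc} (h : Le u v) : Le u.swap v.swap :=
  Relation.ReflTransGen.lift swap
    (fun _ _ h => ⟨refl_swap h.1, by rw [swap_len, swap_len]; exact h.2⟩) _ _ h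

theorem cov_swap {u v : Alc} (h : Cov u v) : Cov u.swap v.swap :=
  ⟨refl_swap h.1, by rw [swap_len, swap_len]; exact h.2⟩

/-- `z` is at distance at least four from `x`, and at most two atoms of `[x, z]` exist. -/
def Dih (C : Alc → Alc → Prop) (x z : Alc) : Prop :=
  (∃ w₁ w₂ w₃ w₄, C x w₁ ∧ C w₁ w₂ ∧ C w₂ w₃ ∧ C w₃ w₄ ∧ Relation.ReflTransGen C w₄ z) ∧
  ∀ c₁ c₂ c₃, C x c₁ → C x c₂ → C x c₃ → Relation.ReflTransGen C c₁ z →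
    Relation.ReflTransGen C c₂ z → Relation.ReflTransGen C c₃ z → c₁ = c₂ ∨ c₁ = c₃ ∨ c₂ = c₃

theorem cov_line_two {x w : Alc} (hx : Dom x) (h : Cov x w) (hd : line 2 w = line 2 x) :
    w.a = -x.b ∨ (x.e = 1 ∧ w.a = x.a) := by
  have he : w.e = 1 - x.e := h.1.elim And.left (Or.rec And.left And.left)
  have hl := h.2
  have := x.he
  simp only [Dom, X, Y, len, c, line] at *
  lia

theorem cov_cov_line_two {x w v : Alc} (hx : Dom x) (h : Cov x w) (h' : Cov w v)
    (hd : line 2 v = line 2 x) : v.a = -x.b ∨ x.e = 0 := by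
  have he : w.e = 1 - x.e := h.1.elim And.left (Or.rec And.left And.left)
  have he' : v.e = 1 - w.e := h'.1.elim And.left (Or.rec And.left And.left)
  have hl := h.2
  have hl' := h'.2
  have := x.he
  simp only [Dom, X, Y, line] at *
  simp only [len, c] at *
  lia

theorem eq_of_line_two {u v : Alc} (h : line 2 u = line 2 v) (ha : u.a = v.a) (he : u.e = v.e) :
    u = v := by
  simp only [line, X, Y] at h
  ext <;> omega

theorem e_eq_of_refl {u v w : Alc} (h : Refl u v) (h' : Refl u w) : v.e = w.e := by
  have := h.imp And.left (Or.imp And.left And.left)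
  have := h'.imp And.left (Or.imp And.left And.left)
  omega

variable {C : Alc → Alc → Prop} {f : Alc → ℤ}

/-- Two distinct atoms and two distinct elements of rank two. -/
theorem CovLike.exists_pairs (hC : CovLike C f) {x z : Alc} {d : Fin 3} (hD : Dih C x z)
    (hd : ∀ u, Relation.ReflTransGen C x u → Relation.ReflTransGen C u z →
      line d u = line d x) :
    ∃ w w' m m', w ≠ w' ∧ m ≠ m' ∧ C x w ∧ C x w' ∧ C w m ∧ C w m' ∧ line d w = line d x ∧
      line d w' = line d x ∧ line d m = line d x ∧ line d m' = line d x := by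
  obtain ⟨⟨w₁, w₂, w₃, w₄, h1, h2, h3, h4, hz⟩, -⟩ := hD
  have hz3 := Relation.ReflTransGen.head h4 hz
  have hz2 := Relation.ReflTransGen.head h3 hz3
  obtain ⟨w₁', hne, h1', h2'⟩ := hC.diamond h1 h2
  obtain ⟨m, hne', hm1, hm2⟩ := hC.diamond h2 h3
  exact ⟨w₁, w₁', w₂, m, hne.symm, hne'.symm, h1, h1', h2, hm1, hd _ (.single h1) (.head h2 hz2),
    hd _ (.single h1') (.head h2' hz2), hd _ (.tail (.single h1) h2) hz2,
    hd _ (.tail (.single h1) hm1) (.head hm2 hz3)⟩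

theorem not_line_two_up {x z : Alc} (hx : Dom x) (hD : Dih Cov x z)
    (hd : ∀ u, Relation.ReflTransGen Cov x u → Relation.ReflTransGen Cov u z →
      line 2 u = line 2 x) : False := by
  obtain ⟨w, w', m, m', hne, hne', h1, h1', h2, h2', l1, l1', l2, l2'⟩ :=
    covLike_cov.exists_pairs hD hd
  have a1 := cov_line_two hx h1 l1
  have a1' := cov_line_two hx h1' l1'
  have a2 := cov_cov_line_two hx h1 h2 l2
  have a2' := cov_cov_line_two hx h1 h2' l2'
  by_cases he : x.e = 0
  · exact hne (eq_of_line_two (l1.trans l1'.symm) (by omega) (e_eq_of_refl h1.1 h1'.1))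
  · exact hne' (eq_of_line_two (l2.trans l2'.symm) (by omega) (e_eq_of_refl h2.1 h2'.1))

theorem cov_line_two_down {y w : Alc} (hy : Dom y) (h : Cov w y) (hd : line 2 w = line 2 y) :
    w.a = y.a := by
  have he : y.e = 1 - w.e := h.1.elim And.left (Or.rec And.left And.left)
  have hl := h.2
  have := w.he
  simp only [Dom, X, Y, len, c, line] at *
  lia

theorem not_line_two_down {y z : Alc} (hy : Dom y) (hD : Dih (flip Cov) y z)
    (hd : ∀ u, Relation.ReflTransGen (flip Cov) y u → Relation.ReflTransGen (flip Cov) u z →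
      line 2 u = line 2 y) : False := by
  obtain ⟨w, w', m, m', hne, hne', h1, h1', h2, h2', l1, l1', l2, l2'⟩ :=
    covLike_flip.exists_pairs hD hd
  exact hne (eq_of_line_two (l1.trans l1'.symm)
    ((cov_line_two_down hy h1 l1).trans (cov_line_two_down hy h1' l1').symm)
    (e_eq_of_refl (refl_symm h1.1) (refl_symm h1'.1)))

theorem CovLike.ne_of_dih (hC : CovLike C f) {x z : Alc} (hD : Dih C x z) : z ≠ x := by
  obtain ⟨⟨w₁, w₂, w₃, w₄, h1, h2, h3, h4, hz⟩, -⟩ := hD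
  rintro rfl
  have := hC.grade h1
  have := hC.mono (.head h2 (.head h3 (.head h4 hz)))
  omega

theorem CovLike.le_of_dih (hC : CovLike C f) {x z : Alc} (hD : Dih C x z) :
    Relation.ReflTransGen C x z := by
  obtain ⟨⟨w₁, w₂, w₃, w₄, h1, h2, h3, h4, hz⟩, -⟩ := hD
  exact .head h1 (.head h2 (.head h3 (.head h4 hz)))

theorem okUp_of_line {x z : Alc} (hx : Dom x) (hxz : CLe x z) (hne : z ≠ x)
    (hd : ∀ u, CLe x u → CLe u z → u.Y = x.Y) : OkUp x z := by
  refine covLike_cov.induction (x := x) (z := z) (P := OkUp x) ?_ ?_ hxz hne .refl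
  · exact fun w hw hwz => okUp_base hx hw (hd w (.single hw) hwz)
  · intro v v' u hv hv' hvu hvu' hne huz ok ok'
    have hu := hd u (hv.tail hvu) huz
    exact okUp_step hvu hvu' (hu.trans (hd v hv (.head hvu huz)).symm)
      (hu.trans (hd v' hv' (.head hvu' huz)).symm) hne ok ok'

theorem okDown_of_line {y z : Alc} (hy : Dom y) (hzy : Relation.ReflTransGen (flip Cov) y z)
    (hne : z ≠ y) (hd : ∀ u, Relation.ReflTransGen (flip Cov) y u →
      Relation.ReflTransGen (flip Cov) u z → u.Y = y.Y) : OkDown y z := by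
  refine covLike_flip.induction (x := y) (z := z) (P := OkDown y) ?_ ?_ hzy hne .refl
  · exact fun w hw hwz => okDown_base hy hw (hd w (.single hw) hwz)
  · intro v v' u hv hv' hvu hvu' hne huz ok ok'
    have hu := hd u (hv.tail hvu) huz
    exact okDown_step hvu hvu' (hu.trans (hd v hv (.head hvu huz)).symm)
      (hu.trans (hd v' hv' (.head hvu' huz)).symm) hne ok ok'

theorem cle_swap {u v : Alc} (h : CLe u v) : CLe u.swap v.swap :=
  Relation.ReflTransGen.lift swap (fun _ _ h => cov_swap h) _ _ h

theorem flip_cle_swap {u v : Alc} (h : Relation.ReflTransGen (flip Cov) u v) :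
    Relation.ReflTransGen (flip Cov) u.swap v.swap :=
  Relation.ReflTransGen.lift (r := flip Cov) (p := flip Cov) swap (fun _ _ h => cov_swap h) _ _ h

theorem okUp_of_dih {x z : Alc} (hx : Dom x) (hD : Dih Cov x z) :
    (z.Y = x.Y ∧ OkUp x z) ∨ (z.X = x.X ∧ OkUp x.swap z.swap) := by
  have hxz := covLike_cov.le_of_dih hD
  have hne := covLike_cov.ne_of_dih hD
  obtain ⟨⟨w₁, w₂, w₃, w₄, h1, h2, h3, h4, hz⟩, hat⟩ := id hD
  obtain ⟨d, hd⟩ := covLike_cov.exists_line h1 h2 h3 h4 hz hat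
  match d with
  | 0 => exact Or.inl ⟨hd z hxz .refl, okUp_of_line hx hxz hne hd⟩
  | 1 =>
    refine Or.inr ⟨hd z hxz .refl, okUp_of_line hx.symm (cle_swap hxz) ?_ ?_⟩
    · exact fun h => hne (congrArg swap h)
    · intro u hu huz
      rw [swap_Y, ← swap_X]
      exact hd _ (cle_swap hu) (cle_swap huz)
  | 2 => exact (not_line_two_up hx hD hd).elim

theorem okDown_of_dih {y z : Alc} (hy : Dom y) (hD : Dih (flip Cov) y z) :
    (z.Y = y.Y ∧ OkDown y z) ∨ (z.X = y.X ∧ OkDown y.swap z.swap) := by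
  have hxz := covLike_flip.le_of_dih hD
  have hne := covLike_flip.ne_of_dih hD
  obtain ⟨⟨w₁, w₂, w₃, w₄, h1, h2, h3, h4, hz⟩, hat⟩ := id hD
  obtain ⟨d, hd⟩ := covLike_flip.exists_line h1 h2 h3 h4 hz hat
  match d with
  | 0 => exact Or.inl ⟨hd z hxz .refl, okDown_of_line hy hxz hne hd⟩
  | 1 =>
    refine Or.inr ⟨hd z hxz .refl, okDown_of_line hy.symm (flip_cle_swap hxz) ?_ ?_⟩
    · exact fun h => hne (congrArg swap h)
    · intro u hu huz
      rw [swap_Y, ← swap_X]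
      exact hd _ (flip_cle_swap hu) (flip_cle_swap huz)
  | 2 => exact (not_line_two_down hy hD hd).elim

/-- The support function, in the directions of the orbit of `ϖ₁`, of the finite orbit. -/
def F (u : Alc) : ℤ := max u.X (max (u.Y - u.X) (-u.Y))

/-- The analogue of `F` for reflections around the point `-ρ`. -/
def G (u : Alc) : ℤ := max (u.X + 2) (max (u.Y - u.X - 1) (-u.Y - 1))

theorem F_le_of_edge {u v : Alc} (h : Edge u v) : u.F ≤ v.F := by
  obtain ⟨h | h | h, hl⟩ := h
  · have hl := (len_lt_iff_of_refl1 h).1 hl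
    obtain ⟨h1, h2⟩ := h
    have := u.he
    simp only [F, max_le_iff, le_max_iff, X, Y, c] at *; omega
  · have hl := (len_lt_iff_of_refl2 h).1 hl
    obtain ⟨h1, h2⟩ := h
    have := u.he
    simp only [F, max_le_iff, le_max_iff, X, Y, c] at *; omega
  · have hl := (len_lt_iff_of_refl3 h).1 hl
    obtain ⟨h1, h2⟩ := h
    have := u.he
    simp only [F, max_le_iff, le_max_iff, X, Y, c] at *; omega

theorem G_le_of_edge {u v : Alc} (h : Edge u v) : u.G ≤ v.G := by
  obtain ⟨h | h | h, hl⟩ := h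
  · have hl := (len_lt_iff_of_refl1 h).1 hl
    obtain ⟨h1, h2⟩ := h
    have := u.he
    simp only [G, max_le_iff, le_max_iff, X, Y, c] at *; omega
  · have hl := (len_lt_iff_of_refl2 h).1 hl
    obtain ⟨h1, h2⟩ := h
    have := u.he
    simp only [G, max_le_iff, le_max_iff, X, Y, c] at *; omega
  · have hl := (len_lt_iff_of_refl3 h).1 hl
    obtain ⟨h1, h2⟩ := h
    have := u.he
    simp only [G, max_le_iff, le_max_iff, X, Y, c] at *; omega

theorem F_le_of_le {u v : Alc} (h : Le u v) : u.F ≤ v.F := by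
  induction h with
  | refl => exact le_rfl
  | tail _ h ih => exact ih.trans (F_le_of_edge h)

theorem G_le_of_le {u v : Alc} (h : Le u v) : u.G ≤ v.G := by
  induction h with
  | refl => exact le_rfl
  | tail _ h ih => exact ih.trans (G_le_of_edge h)

theorem F_eq_of_dom {u : Alc} (h : Dom u) : u.F = u.X := by
  have := u.he
  simp only [Dom] at h
  simp only [F, X, Y]; omega

theorem X_le_F (u : Alc) : u.X ≤ u.F := le_max_left _ _

theorem X_le_X_of_le {x y : Alc} (hy : Dom y) (h : Le x y) : x.X ≤ y.X :=
  (X_le_F x).trans ((F_le_of_le h).trans_eq (F_eq_of_dom hy))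

theorem Y_le_Y_of_le {x y : Alc} (hy : Dom y) (h : Le x y) : x.Y ≤ y.Y := by
  have := X_le_X_of_le (x := x.swap) (y := y.swap) hy.symm (le_swap h)
  rwa [swap_X, swap_X] at this

theorem cov_of_inF {u v : Alc} (hu : InF u) (hv : InF v) (h : Refl u v)
    (hl : v.a + v.b + v.c = u.a + u.b + u.c + 1) : Cov u v := by
  refine ⟨h, ?_⟩
  simp only [InF] at hu hv
  simp only [len]
  omega

/-- Within `F_id`, the Bruhat order contains the order given by the cone `K`. -/
theorem le_of_inF_aux (n : ℕ) {u v : Alc} (hn : v.X + v.Y - u.X - u.Y ≤ n) (hu : InF u) (hv : InF v)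
    (hX : u.X ≤ v.X) (hY : u.Y ≤ v.Y) : Le u v := by
  induction n generalizing u with
  | zero =>
    rw [ext' (u := u) (v := v) (by omega) (by omega)]
    exact .refl
  | succ n ih =>
    by_cases huv : u = v
    · rw [huv]; exact .refl
    have hne : u.X < v.X ∨ u.Y < v.Y := by
      by_contra! hc
      exact huv (ext' (by omega) (by omega))
    have hue := u.he
    have hve := v.he
    have key : ∃ w : Alc, Refl u w ∧ InF w ∧ w.a + w.b + w.c = u.a + u.b + u.c + 1 ∧
        w.X ≤ v.X ∧ w.Y ≤ v.Y ∧ u.X + u.Y < w.X + w.Y := by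
      rcases hue with he | he
      · rcases hne with h | h
        · refine ⟨⟨u.a + 1, u.b, 1, Or.inr rfl⟩, Or.inl ?_, ?_⟩ <;>
            simp only [Refl1, InF, X, Y, c] at * <;> omega
        · refine ⟨⟨u.a, u.b + 1, 1, Or.inr rfl⟩, Or.inr (Or.inl ?_), ?_⟩ <;>
            simp only [Refl2, InF, X, Y, c] at * <;> omega
      · by_cases h : u.X < v.X ∧ u.Y < v.Y
        · refine ⟨⟨u.a, u.b, 0, Or.inl rfl⟩, Or.inr (Or.inr ?_), ?_⟩ <;>
            simp only [Refl3, InF, X, Y, c] at * <;> omega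
        · rcases hne with h' | h'
          · refine ⟨⟨u.a + 1, u.b - 1, 0, Or.inl rfl⟩, Or.inl ?_, ?_⟩ <;>
              simp only [Refl1, InF, X, Y, c] at * <;> omega
          · refine ⟨⟨u.a - 1, u.b + 1, 0, Or.inl rfl⟩, Or.inr (Or.inl ?_), ?_⟩ <;>
              simp only [Refl2, InF, X, Y, c] at * <;> omega
    obtain ⟨w, h1, h2, h3, h4, h5, h6⟩ := key
    exact .head (edge_of_cov (cov_of_inF hu h2 h1 h3)) (ih (by push_cast at hn; omega) h2 h4 h5)

theorem le_of_inF {u v : Alc} (hu : InF u) (hv : InF v) (hX : u.X ≤ v.X) (hY : u.Y ≤ v.Y) :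
    Le u v :=
  le_of_inF_aux (v.X + v.Y - u.X - u.Y).toNat (Int.self_le_toNat _) hu hv hX hY

theorem Dom.inF {u : Alc} (h : Dom u) : InF u := by
  have := u.he
  simp only [Dom, InF, c] at *; omega

/-- `z` is the last alcove on the `α₁`-ray from `x` inside the polygon. -/
def TopZ (x y z : Alc) : Prop :=
  InF z ∧ z.Y = x.Y ∧ x.X ≤ z.X ∧ z.X ≤ y.X ∧
    ∀ p, InF p → p.Y = x.Y → x.X ≤ p.X → p.X ≤ y.X → p.X ≤ z.X

/-- `z` is the last alcove on the `(-α₁)`-ray from `y` inside the polygon. -/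
def BotZ (x y z : Alc) : Prop :=
  InF z ∧ z.Y = y.Y ∧ x.X ≤ z.X ∧ z.X ≤ y.X ∧
    ∀ p, InF p → p.Y = y.Y → x.X ≤ p.X → p.X ≤ y.X → z.X ≤ p.X

variable {x y z : Alc}

theorem TopZ.le (h : TopZ x y z) (hx : Dom x) (hy : Dom y) (hxy : Le x y) : Le x z ∧ Le z y :=
  ⟨le_of_inF hx.inF h.1 h.2.2.1 h.2.1.ge,
    le_of_inF h.1 hy.inF h.2.2.2.1 (h.2.1.trans_le (Y_le_Y_of_le hy hxy))⟩

theorem BotZ.le (h : BotZ x y z) (hx : Dom x) (hy : Dom y) (hxy : Le x y) : Le x z ∧ Le z y :=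
  ⟨le_of_inF hx.inF h.1 h.2.2.1 ((Y_le_Y_of_le hy hxy).trans_eq h.2.1.symm),
    le_of_inF h.1 hy.inF h.2.2.2.1 h.2.1.le⟩

theorem F_sr_one (u : Alc) : (sr 1 u).F = u.F := by
  simp only [F, sr, X, Y, c]
  lia

theorem G_dn (u : Alc) : (dn u).G = u.G := by
  simp only [G, dn, X, Y, c]
  lia

theorem G_eq_of_inF {u : Alc} (h : InF u) : u.G = u.X + 2 := by
  have := u.he
  simp only [InF, c] at h
  simp only [G, X, Y]; omega

theorem sr_one_Y (u : Alc) : (sr 1 u).Y = u.Y := by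
  simp only [sr, Y, c]; ring

theorem dn_Y (u : Alc) : (dn u).Y = u.Y := by
  simp only [dn, Y, c]; ring

theorem TopZ.le_of_okUp (h : TopZ x y z) (hy : Dom y) {r : Alc} (hr : Le r y) (hY : r.Y = x.Y)
    (hok : OkUp x r) : Le r z := by
  have hF := (F_le_of_le hr).trans_eq (F_eq_of_dom hy)
  rcases hok with ⟨h1, h2⟩ | ⟨h1, h2, h3⟩
  · exact le_of_inF h1 h.1 (h.2.2.2.2 r h1 hY h2 ((X_le_F r).trans hF)) (hY.trans h.2.1.symm).le
  · have hY' := (sr_one_Y r).trans hY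
    refine .head (edge_sr_of_lt (i := 1) (by omega)) (le_of_inF h1 h.1
      (h.2.2.2.2 _ h1 hY' h2 ((X_le_F _).trans ?_)) (hY'.trans h.2.1.symm).le)
    rwa [F_sr_one]

theorem BotZ.le_of_okDown (h : BotZ x y z) (hx : Dom x) {r : Alc} (hr : Le x r) (hY : r.Y = y.Y)
    (hok : OkDown y r) : Le z r := by
  have hG := (G_eq_of_inF hx.inF).ge.trans (G_le_of_le hr)
  rcases hok with ⟨h1, h2⟩ | ⟨h1, h2, h3⟩
  · rw [G_eq_of_inF h1] at hG
    exact le_of_inF h.1 h1 (h.2.2.2.2 r h1 hY (by omega) h2) (h.2.1.trans hY.symm).le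
  · rw [← G_dn, G_eq_of_inF h1] at hG
    have hY' := (dn_Y r).trans hY
    refine .tail (le_of_inF h.1 h1 (h.2.2.2.2 _ h1 hY' (by omega) h2) (h.2.1.trans hY'.symm).le)
      ⟨Or.inl ⟨?_, dn_Y r⟩, by omega⟩
    simp only [dn]; ring

theorem CovLike.exists_chain {C : Alc → Alc → Prop} {f : Alc → ℤ} (hC : CovLike C f)
    (h : Relation.ReflTransGen C x z) (hl : f x + 4 ≤ f z) :
    ∃ w₁ w₂ w₃ w₄, C x w₁ ∧ C w₁ w₂ ∧ C w₂ w₃ ∧ C w₃ w₄ ∧ Relation.ReflTransGen C w₄ z := by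
  rcases h.cases_head with rfl | ⟨w₁, h1, h⟩
  · omega
  have := hC.grade h1
  rcases h.cases_head with rfl | ⟨w₂, h2, h⟩
  · omega
  have := hC.grade h2
  rcases h.cases_head with rfl | ⟨w₃, h3, h⟩
  · omega
  have := hC.grade h3
  rcases h.cases_head with rfl | ⟨w₄, h4, h⟩
  · omega
  exact ⟨w₁, w₂, w₃, w₄, h1, h2, h3, h4, h⟩

theorem eq_of_Y {u v : Alc} (h : u.Y = v.Y) (ha : u.a = v.a) (he : u.e = v.e) : u = v := by
  simp only [Y] at h
  ext <;> omega

theorem a_of_cov_up (hx : Dom x) {w : Alc} (h : Cov x w) (hY : w.Y = x.Y) :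
    w.a = x.a + 1 ∨ w.a = -1 - x.a := by
  have hl := h.2
  have h1 := len_eq_of_inF hx.inF
  rcases okUp_base hx h hY with ⟨h2, -⟩ | ⟨h2, -, h3⟩
  · have h4 := len_eq_of_inF h2
    omega
  · have h4 := len_eq_of_inF h2
    rw [sr_one_Y] at h4
    simp only [sr] at h3 h4
    omega

theorem a_of_cov_down (hy : Dom y) {w : Alc} (h : Cov w y) (hY : w.Y = y.Y) :
    w.a = y.a - 1 ∨ w.a = 1 - y.a := by
  have hl := h.2
  have h1 := len_eq_of_inF hy.inF
  rcases okDown_base hy h hY with ⟨h2, -⟩ | ⟨h2, -, h3⟩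
  · have h4 := len_eq_of_inF h2
    omega
  · have h4 := len_eq_of_inF h2
    rw [dn_Y] at h4
    simp only [dn] at h3 h4
    omega

theorem Y_eq_of_cov_up (hx : Dom x) {w : Alc} (h : Cov x w) (hF : w.swap.F ≤ x.Y + 2)
    (hG : w.swap.G ≤ x.Y + 2) : w.Y = x.Y := by
  have hl := h.2
  have hr := h.1
  have he := x.he
  simp only [F, G, swap_X, swap_Y] at hF hG
  simp only [Refl, Refl1, Refl2, Refl3, Dom, X, Y, len, c] at *
  lia

theorem Y_eq_of_cov_down (hy : Dom y) {w : Alc} (h : Cov w y) (hG : y.Y + 2 ≤ w.swap.G) :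
    w.Y = y.Y := by
  have hl := h.2
  have hr := h.1
  have he := w.he
  simp only [G, swap_X, swap_Y] at hG
  simp only [Refl, Refl1, Refl2, Refl3, Dom, X, Y, len, c] at *
  lia

theorem TopZ.Y_eq (h : TopZ x y z) (hx : Dom x) {w : Alc} (hw : Cov x w) (hwz : Le w z) :
    w.Y = x.Y := by
  refine Y_eq_of_cov_up hx hw ((F_le_of_le (le_swap hwz)).trans ?_)
    ((G_le_of_le (le_swap hwz)).trans ?_)
  · rw [← h.2.1]
    have := h.1
    have := z.he
    simp only [F, swap_X, swap_Y]
    simp only [InF, X, Y, c] at *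
    omega
  · rw [← h.2.1]
    have := h.1
    have := z.he
    simp only [G, swap_X, swap_Y]
    simp only [InF, X, Y, c] at *
    omega

theorem BotZ.Y_eq (h : BotZ x y z) (hy : Dom y) {w : Alc} (hw : Cov w y) (hwz : Le z w) :
    w.Y = y.Y := by
  refine Y_eq_of_cov_down hy hw (le_trans ?_ (G_le_of_le (le_swap hwz)))
  rw [← h.2.1, ← swap_X]
  exact le_max_left _ _

theorem TopZ.dih (h : TopZ x y z) (hx : Dom x) (hl : x.len + 4 ≤ z.len) : Dih Cov x z := by
  refine ⟨covLike_cov.exists_chain (cle_of_le (le_of_inF hx.inF h.1 h.2.2.1 h.2.1.ge))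
    (by omega), ?_⟩
  intro c₁ c₂ c₃ h1 h2 h3 l1 l2 l3
  have y1 := h.Y_eq hx h1 (le_of_cle l1)
  have y2 := h.Y_eq hx h2 (le_of_cle l2)
  have y3 := h.Y_eq hx h3 (le_of_cle l3)
  have a1 := a_of_cov_up hx h1 y1
  have a2 := a_of_cov_up hx h2 y2
  have a3 := a_of_cov_up hx h3 y3
  by_cases h12 : c₁.a = c₂.a
  · exact Or.inl (eq_of_Y (y1.trans y2.symm) h12 (e_eq_of_refl h1.1 h2.1))
  by_cases h13 : c₁.a = c₃.a
  · exact Or.inr (Or.inl (eq_of_Y (y1.trans y3.symm) h13 (e_eq_of_refl h1.1 h3.1)))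
  · exact Or.inr (Or.inr (eq_of_Y (y2.trans y3.symm) (by omega) (e_eq_of_refl h2.1 h3.1)))

theorem flip_cle_iff {u v : Alc} : Relation.ReflTransGen (flip Cov) u v ↔ CLe v u :=
  Relation.reflTransGen_swap

theorem BotZ.dih (h : BotZ x y z) (hy : Dom y) (hl : z.len + 4 ≤ y.len) :
    Dih (flip Cov) y z := by
  constructor
  · exact covLike_flip.exists_chain
      (flip_cle_iff.2 (cle_of_le (le_of_inF h.1 hy.inF h.2.2.2.1 h.2.1.le))) (by omega)
  intro c₁ c₂ c₃ h1 h2 h3 l1 l2 l3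
  have y1 := h.Y_eq hy h1 (le_of_cle (flip_cle_iff.1 l1))
  have y2 := h.Y_eq hy h2 (le_of_cle (flip_cle_iff.1 l2))
  have y3 := h.Y_eq hy h3 (le_of_cle (flip_cle_iff.1 l3))
  have a1 := a_of_cov_down hy h1 y1
  have a2 := a_of_cov_down hy h2 y2
  have a3 := a_of_cov_down hy h3 y3
  have e12 := e_eq_of_refl (refl_symm h1.1) (refl_symm h2.1)
  have e13 := e_eq_of_refl (refl_symm h1.1) (refl_symm h3.1)
  by_cases h12 : c₁.a = c₂.a
  · exact Or.inl (eq_of_Y (y1.trans y2.symm) h12 e12)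
  by_cases h13 : c₁.a = c₃.a
  · exact Or.inr (Or.inl (eq_of_Y (y1.trans y3.symm) h13 e13))
  · exact Or.inr (Or.inr (eq_of_Y (y2.trans y3.symm) (by omega) (e12.symm.trans e13)))

theorem not_le_of_topZ {z₁ z₂ : Alc} (h₁ : TopZ x y z₁) (h₂ : TopZ x.swap y.swap z₂.swap)
    (hx : Dom x) (hne : z₁ ≠ x) : ¬ Le z₁ z₂ := by
  intro h
  obtain ⟨w, hw, hwz⟩ := exists_cov_of_le (le_of_inF hx.inF h₁.1 h₁.2.2.1 h₁.2.1.ge) hne.symm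
  have e1 := h₁.Y_eq hx hw hwz
  have e2 := h₂.Y_eq (x := x.swap) hx.symm (cov_swap hw) (le_swap (hwz.trans h))
  rw [swap_Y, swap_Y] at e2
  have := hw.2
  rw [ext' e2 e1] at this
  omega

theorem not_le_of_botZ {z₁ z₂ : Alc} (h₁ : BotZ x y z₁) (h₂ : BotZ x.swap y.swap z₂.swap)
    (hy : Dom y) (hne : z₁ ≠ y) : ¬ Le z₂ z₁ := by
  intro h
  obtain ⟨w, hwz, hw⟩ := (cle_of_le
    (le_of_inF h₁.1 hy.inF h₁.2.2.2.1 h₁.2.1.le)).cases_tail.resolve_left hne.symm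
  have hwz := le_of_cle hwz
  have e1 := h₁.Y_eq hy hw hwz
  have e2 := h₂.Y_eq (y := y.swap) hy.symm (cov_swap hw) (le_swap (h.trans hwz))
  rw [swap_Y, swap_Y] at e2
  have := hw.2
  rw [ext' e2 e1] at this
  omega

end Alc

/-- A notion, invariant under isomorphisms of posets, of an element of rank at least four above
at most two atoms. -/
def OrderDih {I : Type*} (r : I → I → Prop) (z : I) : Prop :=
  (∃ w₀ w₁ w₂ w₃ w₄, r w₀ w₁ ∧ w₀ ≠ w₁ ∧ r w₁ w₂ ∧ w₁ ≠ w₂ ∧ r w₂ w₃ ∧ w₂ ≠ w₃ ∧ r w₃ w₄ ∧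
    w₃ ≠ w₄ ∧ r w₄ z) ∧
  ∀ c₁ c₂ c₃, (∃! u, r u c₁ ∧ u ≠ c₁) → (∃! u, r u c₂ ∧ u ≠ c₂) → (∃! u, r u c₃ ∧ u ≠ c₃) →
    r c₁ z → r c₂ z → r c₃ z → c₁ = c₂ ∨ c₁ = c₃ ∨ c₂ = c₃

theorem OrderDih.map {I J : Type*} {r : I → I → Prop} {s : J → J → Prop} (φ : I ≃ J)
    (hφ : ∀ u v, r u v ↔ s (φ u) (φ v)) {z : I} (h : OrderDih r z) : OrderDih s (φ z) := by
  obtain ⟨⟨w₀, w₁, w₂, w₃, w₄, h1, n1, h2, n2, h3, n3, h4, n4, h5⟩, hat⟩ := h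
  refine ⟨⟨φ w₀, φ w₁, φ w₂, φ w₃, φ w₄, (hφ _ _).1 h1, φ.injective.ne n1, (hφ _ _).1 h2,
    φ.injective.ne n2, (hφ _ _).1 h3, φ.injective.ne n3, (hφ _ _).1 h4, φ.injective.ne n4,
    (hφ _ _).1 h5⟩, ?_⟩
  have key : ∀ c, (∃! u, s u c ∧ u ≠ c) → ∃! u, r u (φ.symm c) ∧ u ≠ φ.symm c := by
    rintro c ⟨u, ⟨hu, hne⟩, huniq⟩
    refine ⟨φ.symm u, ⟨by simpa [hφ] using hu, φ.symm.injective.ne hne⟩, fun v hv => ?_⟩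
    rw [Equiv.eq_symm_apply]
    refine huniq (φ v) ⟨by simpa [hφ] using hv.1, fun h => hv.2 ?_⟩
    rw [← h, Equiv.symm_apply_apply]
  intro c₁ c₂ c₃ a1 a2 a3 l1 l2 l3
  have := hat (φ.symm c₁) (φ.symm c₂) (φ.symm c₃) (key _ a1) (key _ a2) (key _ a3)
    (by simpa [hφ] using l1) (by simpa [hφ] using l2) (by simpa [hφ] using l3)
  simpa using this

namespace Alc

variable {C : Alc → Alc → Prop} {f : Alc → ℤ}

theorem CovLike.eq_of_le (hC : CovLike C f) {u v : Alc} (h : Relation.ReflTransGen C u v)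
    (hf : f v ≤ f u) : u = v := by
  rcases h.cases_head with h | ⟨w, hw, h⟩
  · exact h
  · have := hC.mono h
    have := hC.grade hw
    omega

theorem CovLike.lt (hC : CovLike C f) {u v : Alc} (h : Relation.ReflTransGen C u v)
    (hne : u ≠ v) : f u < f v := by
  by_contra! hf
  exact hne (hC.eq_of_le h hf)

theorem CovLike.orderDih_iff (hC : CovLike C f) {x y : Alc} {I : Type*} {val : I → Alc}
    (hinj : Function.Injective val)
    (hval : ∀ u, (∃ i, val i = u) ↔ Relation.ReflTransGen C x u ∧ Relation.ReflTransGen C u y)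
    (z : I) :
    OrderDih (fun i j => Relation.ReflTransGen C (val i) (val j)) z ↔ Dih C x (val z) := by
  have hI : ∀ i, Relation.ReflTransGen C x (val i) ∧ Relation.ReflTransGen C (val i) y :=
    fun i => (hval _).1 ⟨i, rfl⟩
  have ex : ∀ u, Relation.ReflTransGen C x u → Relation.ReflTransGen C u (val z) →
      ∃ i, val i = u := fun u h h' => (hval u).2 ⟨h, h'.trans (hI z).2⟩
  have atom : ∀ c, C x (val c) ↔
      ∃! u, Relation.ReflTransGen C (val u) (val c) ∧ u ≠ c := by
    intro c
    constructor
    · intro h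
      obtain ⟨x₀, hx₀⟩ := (hval x).2 ⟨.refl, (hI z).1.trans (hI z).2⟩
      have hg := hC.grade h
      refine ⟨x₀, ⟨by simpa only [hx₀] using .single h, ?_⟩, fun v hv => hinj ?_⟩
      · rintro rfl
        rw [hx₀] at hg; omega
      · have := hC.lt hv.1 (hinj.ne hv.2)
        exact (hx₀.trans (hC.eq_of_le (hI v).1 (by omega))).symm
    · rintro ⟨u, hu, huniq⟩
      rcases (hI c).1.cases_tail with h | ⟨w, hw, hwc⟩
      · have := hC.lt hu.1 (hinj.ne hu.2)
        have := hC.mono (hI u).1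
        rw [h] at *
        omega
      · obtain ⟨x₀, hx₀⟩ := (hval x).2 ⟨.refl, (hI c).1.trans (hI c).2⟩
        obtain ⟨w₀, rfl⟩ := (hval w).2 ⟨hw, .head hwc (hI c).2⟩
        have hg := hC.grade hwc
        have hm := hC.mono hw
        have e1 := huniq w₀ ⟨.single hwc, by rintro rfl; omega⟩
        have e2 := huniq x₀ ⟨by simpa only [hx₀] using (hI c).1, by
          rintro rfl; rw [hx₀] at hg; omega⟩
        rwa [← hx₀, e2, ← e1]
  constructor
  · rintro ⟨⟨w₀, w₁, w₂, w₃, w₄, h1, n1, h2, n2, h3, n3, h4, n4, h5⟩, hat⟩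
    refine ⟨hC.exists_chain (hI z).1 ?_, ?_⟩
    · have := hC.mono (hI w₀).1
      have := hC.lt h1 (hinj.ne n1)
      have := hC.lt h2 (hinj.ne n2)
      have := hC.lt h3 (hinj.ne n3)
      have := hC.lt h4 (hinj.ne n4)
      have := hC.mono h5
      omega
    · intro c₁ c₂ c₃ a1 a2 a3 l1 l2 l3
      obtain ⟨c₁, rfl⟩ := ex c₁ (.single a1) l1
      obtain ⟨c₂, rfl⟩ := ex c₂ (.single a2) l2
      obtain ⟨c₃, rfl⟩ := ex c₃ (.single a3) l3
      rw [hinj.eq_iff, hinj.eq_iff, hinj.eq_iff]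
      exact hat c₁ c₂ c₃ ((atom _).1 a1) ((atom _).1 a2) ((atom _).1 a3) l1 l2 l3
  · rintro ⟨⟨w₁, w₂, w₃, w₄, h1, h2, h3, h4, h5⟩, hat⟩
    have ne : ∀ {i j}, C (val i) (val j) → i ≠ j := by
      rintro i j h rfl
      have := hC.grade h
      omega
    obtain ⟨w₀, rfl⟩ := ex x .refl (hI z).1
    obtain ⟨w₁, rfl⟩ := ex w₁ (.single h1) (.head h2 (.head h3 (.head h4 h5)))
    obtain ⟨w₂, rfl⟩ := ex w₂ (.head h1 (.single h2)) (.head h3 (.head h4 h5))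
    obtain ⟨w₃, rfl⟩ := ex w₃ (.head h1 (.head h2 (.single h3))) (.head h4 h5)
    obtain ⟨w₄, rfl⟩ := ex w₄ (.head h1 (.head h2 (.head h3 (.single h4)))) h5
    refine ⟨⟨w₀, w₁, w₂, w₃, w₄, .single h1, ne h1, .single h2, ne h2, .single h3, ne h3,
      .single h4, ne h4, h5⟩, ?_⟩
    intro c₁ c₂ c₃ a1 a2 a3 l1 l2 l3
    rw [← hinj.eq_iff, ← hinj.eq_iff (a := c₁) (b := c₃), ← hinj.eq_iff (a := c₂)]
    exact hat _ _ _ ((atom _).2 a1) ((atom _).2 a2) ((atom _).2 a3) l1 l2 l3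

theorem CovLike.map_pair (hC : CovLike C f) {x y x' y' : Alc} {I J : Type*}
    {val : I → Alc} (hinj : Function.Injective val)
    (hval : ∀ u, (∃ i, val i = u) ↔ Relation.ReflTransGen C x u ∧ Relation.ReflTransGen C u y)
    {val' : J → Alc} (hinj' : Function.Injective val')
    (hval' : ∀ u, (∃ i, val' i = u) ↔
      Relation.ReflTransGen C x' u ∧ Relation.ReflTransGen C u y')
    (φ : I ≃ J) (hφ : ∀ i j, Relation.ReflTransGen C (val i) (val j) ↔
      Relation.ReflTransGen C (val' (φ i)) (val' (φ j)))
    {z₁ z₂ : I} {z₁' z₂' : J} (h₁ : Dih C x (val z₁)) (h₂ : Dih C x (val z₂))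
    (h12 : ¬ Relation.ReflTransGen C (val z₁) (val z₂))
    (h21 : ¬ Relation.ReflTransGen C (val z₂) (val z₁))
    (hmax : ∀ d, Dih C x (val d) → Relation.ReflTransGen C (val d) (val z₁) ∨
      Relation.ReflTransGen C (val d) (val z₂))
    (hmax' : ∀ d, Dih C x' (val' d) → Relation.ReflTransGen C (val' d) (val' z₁') ∨
      Relation.ReflTransGen C (val' d) (val' z₂'))
    (h₁' : f x' + 4 ≤ f (val' z₁') → Dih C x' (val' z₁'))
    (h₂' : f x' + 4 ≤ f (val' z₂') → Dih C x' (val' z₂')) :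
    (φ z₁ = z₁' ∧ φ z₂ = z₂') ∨ (φ z₁ = z₂' ∧ φ z₂ = z₁') := by
  have iff := hC.orderDih_iff hinj hval
  have iff' := hC.orderDih_iff hinj' hval'
  have fwd : ∀ z, Dih C x (val z) → Dih C x' (val' (φ z)) := fun z hz =>
    (iff' _).1 (((iff z).2 hz).map φ hφ)
  have bwd : ∀ z, Dih C x' (val' z) → Dih C x (val (φ.symm z)) := fun z hz =>
    (iff _).1 (((iff' z).2 hz).map φ.symm fun u v => by simp [hφ])
  have far : ∀ {z z'}, Dih C x' (val' z) → Relation.ReflTransGen C (val' z) (val' z') →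
      f x' + 4 ≤ f (val' z') := by
    intro z z' h hz
    obtain ⟨⟨w₁, w₂, w₃, w₄, h1, h2, h3, h4, h5⟩, -⟩ := h
    have := hC.grade h1
    have := hC.grade h2
    have := hC.grade h3
    have := hC.grade h4
    have := hC.mono h5
    have := hC.mono hz
    omega
  have key : ∀ z z', Dih C x (val z) →
      (∀ d, Dih C x (val d) → Relation.ReflTransGen C (val z) (val d) →
        Relation.ReflTransGen C (val d) (val z)) →
      (f x' + 4 ≤ f (val' z') → Dih C x' (val' z')) →
      Relation.ReflTransGen C (val' (φ z)) (val' z') → φ z = z' := by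
    intro z z' hz hm hz' hle
    have hle' : Relation.ReflTransGen C (val z) (val (φ.symm z')) := by simpa [hφ] using hle
    have hge := hm _ (bwd _ (hz' (far (fwd z hz) hle))) hle'
    rw [← Equiv.eq_symm_apply]
    exact hinj (hC.eq_of_le hle' (hC.mono hge))
  have m₁ : ∀ d, Dih C x (val d) → Relation.ReflTransGen C (val z₁) (val d) →
      Relation.ReflTransGen C (val d) (val z₁) := fun d hd hle =>
    (hmax d hd).resolve_right fun h => h12 (hle.trans h)
  have m₂ : ∀ d, Dih C x (val d) → Relation.ReflTransGen C (val z₂) (val d) →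
      Relation.ReflTransGen C (val d) (val z₂) := fun d hd hle =>
    (hmax d hd).resolve_left fun h => h21 (hle.trans h)
  have hne : φ z₁ ≠ φ z₂ := φ.injective.ne (by rintro rfl; exact h12 .refl)
  have e₁ := (hmax' _ (fwd _ h₁)).imp (key z₁ z₁' h₁ m₁ h₁') (key z₁ z₂' h₁ m₁ h₂')
  have e₂ := (hmax' _ (fwd _ h₂)).imp (key z₂ z₁' h₂ m₂ h₁') (key z₂ z₂' h₂ m₂ h₂')
  rcases e₁ with e₁ | e₁ <;> rcases e₂ with e₂ | e₂
  · exact absurd (e₁.trans e₂.symm) hne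
  · exact Or.inl ⟨e₁, e₂⟩
  · exact Or.inr ⟨e₁, e₂⟩
  · exact absurd (e₁.trans e₂.symm) hne

end Alc

/-- A labelling of a Coxeter group by alcoves which is equivariant for the simple reflections. -/
structure AlcCoord {W : Type*} [Group W] {M : CoxeterMatrix (Fin 3)} (cs : CoxeterSystem M W)
    (κ : W → Alc) : Prop where
  one : κ 1 = ⟨0, 0, 0, Or.inl rfl⟩
  mul : ∀ i w, κ (cs.simple i * w) = Alc.sr i (κ w)
  inj : Function.Injective κ

namespace AlcCoord

variable {W : Type*} [Group W] {M : CoxeterMatrix (Fin 3)} {cs : CoxeterSystem M W} {κ : W → Alc}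

theorem len_le (h : AlcCoord cs κ) (w : W) : (κ w).len ≤ cs.length w := by
  obtain ⟨ω, hω, rfl⟩ := cs.exists_isReduced w
  rw [hω.eq]
  clear hω
  induction ω with
  | nil => simp [h.one, Alc.len, Alc.c]
  | cons i ω ih =>
    rw [cs.wordProd_cons, h.mul, List.length_cons]
    rcases Alc.len_sr i (κ (cs.wordProd ω)) with h' | h' <;> omega

theorem exists_eq (h : AlcCoord cs κ) (u : Alc) : ∃ w, κ w = u ∧ cs.length w ≤ u.len := by
  obtain ⟨n, hn⟩ : ∃ n, u.len = n := ⟨_, rfl⟩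
  induction n generalizing u with
  | zero =>
    refine ⟨1, ?_, by simp⟩
    rw [h.one]
    simp only [Alc.len, Alc.c] at hn
    ext <;> simp only [] <;> omega
  | succ n ih =>
    obtain ⟨i, hi⟩ := Alc.exists_len_sr_lt (u := u) (by omega)
    have hl : (Alc.sr i u).len = n := by rcases Alc.len_sr i u with h' | h' <;> omega
    obtain ⟨w, hw, hwl⟩ := ih _ hl
    refine ⟨cs.simple i * w, by rw [h.mul, hw, Alc.sr_sr], ?_⟩
    rcases cs.length_simple_mul w i with h' | h' <;> omega

theorem surj (h : AlcCoord cs κ) : Function.Surjective κ := fun u =>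
  (h.exists_eq u).imp fun _ hw => hw.1

theorem length_eq (h : AlcCoord cs κ) (w : W) : cs.length w = (κ w).len := by
  obtain ⟨v, hv, hl⟩ := h.exists_eq (κ w)
  rw [h.inj hv] at hl
  exact hl.antisymm (h.len_le w)

theorem refl_of_isReflection (h : AlcCoord cs κ) {t : W} (ht : cs.IsReflection t) (g : W) :
    Alc.Refl (κ g) (κ (t * g)) := by
  obtain ⟨w, i, rfl⟩ := ht
  induction w using cs.simple_induction_left generalizing g with
  | one => simpa [h.mul] using Alc.refl_sr i (κ g)
  | mul_simple_left w j ih =>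
    have := Alc.refl_sr_sr j (ih (cs.simple j * g))
    rw [← h.mul, ← h.mul, cs.simple_mul_simple_cancel_left] at this
    simpa [mul_assoc] using this

theorem exists_isReflection (h : AlcCoord cs κ) {u v : W} (huv : Alc.Edge (κ u) (κ v)) :
    ∃ t, cs.IsReflection t ∧ v = t * u := by
  obtain ⟨n, hn⟩ : ∃ n, (κ v).len = n := ⟨_, rfl⟩
  induction n generalizing u v with
  | zero => have := huv.2; omega
  | succ n ih =>
    obtain ⟨i, hi⟩ := Alc.exists_len_sr_lt (u := κ v) (by omega)
    have hl : (Alc.sr i (κ v)).len = n := by rcases Alc.len_sr i (κ v) with h' | h' <;> omega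
    rcases Alc.edge_sr i huv with he | he
    · rw [← h.mul] at he
      exact ⟨cs.simple i, cs.isReflection_simple i, h.inj he⟩
    · rw [← h.mul, ← h.mul] at he
      obtain ⟨t, ht, e⟩ := ih he (by rwa [h.mul])
      refine ⟨cs.simple i * t * (cs.simple i)⁻¹, ht.conj _, ?_⟩
      rw [cs.inv_simple, mul_assoc, mul_assoc, ← e, cs.simple_mul_simple_cancel_left]

theorem edge_iff (h : AlcCoord cs κ) (u v : W) :
    ((∃ t, cs.IsReflection t ∧ v = t * u) ∧ cs.length u < cs.length v) ↔
      Alc.Edge (κ u) (κ v) := by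
  rw [h.length_eq, h.length_eq]
  constructor
  · rintro ⟨⟨t, ht, rfl⟩, hl⟩
    exact ⟨h.refl_of_isReflection ht u, hl⟩
  · exact fun he => ⟨h.exists_isReflection he, he.2⟩

theorem bruhatLE_iff (h : AlcCoord cs κ) (u v : W) :
    bruhatLE cs u v ↔ Alc.Le (κ u) (κ v) := by
  constructor
  · rintro (rfl | huv)
    · exact .refl
    · exact Relation.ReflTransGen.lift κ (fun _ _ e => (h.edge_iff _ _).1 e) _ _ huv.to_reflTransGen
  · intro huv
    obtain ⟨a, ha⟩ : ∃ a, κ v = a := ⟨_, rfl⟩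
    rw [ha] at huv
    induction huv generalizing v with
    | refl => exact Or.inl (h.inj ha).symm
    | @tail b c _ hbc ih =>
      obtain ⟨w, rfl⟩ := h.surj b
      rw [← ha, ← h.edge_iff] at hbc
      rcases ih w rfl with rfl | hw
      · exact Or.inr (.single hbc)
      · exact Or.inr (.tail hw hbc)

end AlcCoord

namespace Alc

/-- The barycenter of an alcove. -/
noncomputable def pt (u : Alc) : E2 := ((u.X : ℝ) / 3, (u.Y : ℝ) / 3)

theorem pt_injective : Function.Injective pt := by
  intro u v h
  simp only [pt, Prod.mk.injEq] at h
  refine ext' ?_ ?_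
  · exact_mod_cast (div_left_inj' (three_ne_zero)).1 h.1
  · exact_mod_cast (div_left_inj' (three_ne_zero)).1 h.2

/-- The closed alcove. -/
def closedAlcove (u : Alc) : Set E2 :=
  {v | ((u.a : ℝ) - 1 ≤ B2 a1 v ∧ B2 a1 v ≤ u.a) ∧ ((u.b : ℝ) - 1 ≤ B2 a2 v ∧ B2 a2 v ≤ u.b) ∧
    ((u.c : ℝ) - 1 ≤ B2 rho2 v ∧ B2 rho2 v ≤ u.c)}

theorem isClosed_closedAlcove (u : Alc) : IsClosed u.closedAlcove := by
  have hc : ∀ r, Continuous (B2 r) := fun r => by unfold B2; fun_prop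
  exact (((isClosed_le continuous_const (hc _)).inter (isClosed_le (hc _) continuous_const)).inter
    (((isClosed_le continuous_const (hc _)).inter (isClosed_le (hc _) continuous_const)).inter
    ((isClosed_le continuous_const (hc _)).inter (isClosed_le (hc _) continuous_const))))

end Alc

section Action

variable {W : Type*} [Group W] {M : CoxeterMatrix (Fin 3)} {cs : CoxeterSystem M W}
  {act : W →* Equiv.Perm E2}

/-- The simple reflections act on the plane as the reflections in the walls of the fundamental
alcove. -/
structure IsAffineAction (cs : CoxeterSystem M W) (act : W →* Equiv.Perm E2) : Prop where
  zero : ∀ v, act (cs.simple 0) v = reflE rho2 (-1) v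
  one : ∀ v, act (cs.simple 1) v = reflE a1 0 v
  two : ∀ v, act (cs.simple 2) v = reflE a2 0 v

theorem IsAffineAction.act_pt (h : IsAffineAction cs act) (i : Fin 3) (u : Alc) :
    act (cs.simple i) u.pt = (Alc.sr i u).pt := by
  match i with
  | 0 =>
    rw [h.zero]
    ext <;> simp [reflE, B2, rho2, Alc.pt, Alc.sr, Alc.X, Alc.Y] <;> ring
  | 1 =>
    rw [h.one]
    ext <;> simp [reflE, B2, a1, Alc.pt, Alc.sr, Alc.X, Alc.Y, Alc.c] <;> ring
  | 2 =>
    rw [h.two]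
    ext <;> simp [reflE, B2, a2, Alc.pt, Alc.sr, Alc.X, Alc.Y, Alc.c] <;> ring

theorem IsAffineAction.act_mem (h : IsAffineAction cs act) (i : Fin 3) {u : Alc} {v : E2}
    (hv : v ∈ u.closedAlcove) : act (cs.simple i) v ∈ (Alc.sr i u).closedAlcove := by
  simp only [Alc.closedAlcove, Set.mem_ofPred_eq, B2, a1, a2, rho2] at hv
  match i with
  | 0 =>
    rw [h.zero]
    simp [Alc.closedAlcove, reflE, B2, a1, a2, rho2, Alc.sr, Alc.c] at hv ⊢
    constructorm* _ ∧ _ <;> linarith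
  | 1 =>
    rw [h.one]
    simp [Alc.closedAlcove, reflE, B2, a1, a2, rho2, Alc.sr, Alc.c] at hv ⊢
    constructorm* _ ∧ _ <;> linarith
  | 2 =>
    rw [h.two]
    simp [Alc.closedAlcove, reflE, B2, a1, a2, rho2, Alc.sr, Alc.c] at hv ⊢
    constructorm* _ ∧ _ <;> linarith

theorem cen_mul (g w : W) : cen act (g * w) = act g (cen act w) := by
  simp [cen]

theorem cen_one : cen act (1 : W) = Alc.pt ⟨0, 0, 0, Or.inl rfl⟩ := by
  ext <;> simp [cen, rho2, Alc.pt, Alc.X, Alc.Y] <;> norm_num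

theorem IsAffineAction.exists_coord (h : IsAffineAction cs act)
    (hcen : Function.Injective (cen act)) :
    ∃ κ : W → Alc, AlcCoord cs κ ∧ (∀ w, cen act w = (κ w).pt) ∧
      ∀ w, closure (act w '' AlcoveFund) ⊆ (κ w).closedAlcove := by
  have key : ∀ w, ∃ u : Alc, cen act w = u.pt ∧ ∀ v ∈ AlcoveFund, act w v ∈ u.closedAlcove := by
    intro w
    induction w using cs.simple_induction_left with
    | one =>
      refine ⟨_, cen_one, fun v hv => ?_⟩
      obtain ⟨⟨h1, h2⟩, ⟨h3, h4⟩, h5, h6⟩ := hv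
      simp [Alc.closedAlcove, Alc.c, *, le_of_lt]
    | mul_simple_left w i ih =>
      obtain ⟨u, hu, hv⟩ := ih
      refine ⟨Alc.sr i u, by rw [cen_mul, hu, h.act_pt], fun v hv' => ?_⟩
      rw [map_mul]
      exact h.act_mem i (hv v hv')
  choose κ hκ hmem using key
  refine ⟨κ, ⟨?_, fun i w => ?_, fun v w hvw => hcen ?_⟩, hκ, fun w => ?_⟩
  · exact Alc.pt_injective ((hκ 1).symm.trans cen_one)
  · exact Alc.pt_injective (by rw [← hκ, cen_mul, hκ, h.act_pt])
  · rw [hκ, hκ, hvw]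
  · refine closure_minimal ?_ (Alc.isClosed_closedAlcove _)
    rintro _ ⟨v, hv, rfl⟩
    exact hmem w v hv

theorem IsAffineAction.dom (h : IsAffineAction cs act) {κ : W → Alc}
    (hκ : ∀ w, cen act w = (κ w).pt) {th ths : ℕ → ℕ → W}
    (hth : ∀ m n : ℕ, cen act (th m n) =
      cen act (cs.simple 1 * cs.simple 2 * cs.simple 1) + (m : ℝ) • fw1 + (n : ℝ) • fw2)
    (hths : ∀ m n : ℕ, cen act (ths m n) =
      cen act 1 + ((m : ℝ) + 1) • fw1 + ((n : ℝ) + 1) • fw2) {x : W} (hx : x ∈ Dset th ths) :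
    (κ x).Dom := by
  obtain ⟨m, n, rfl⟩ | ⟨m, n, rfl⟩ := hx
  · have : κ (th m n) = ⟨m + 1, n + 1, 1, Or.inr rfl⟩ := by
      refine Alc.pt_injective ?_
      rw [← hκ, hth, mul_assoc, cen_mul, cen_mul, ← mul_one (cs.simple 1), cen_mul, cen_one,
        mul_one, h.act_pt, h.act_pt, h.act_pt]
      ext <;> simp [Alc.pt, Alc.X, Alc.Y, Alc.sr, Alc.c, fw1, fw2] <;> ring
    rw [this]
    constructor <;> simp
  · have : κ (ths m n) = ⟨m + 1, n + 1, 0, Or.inl rfl⟩ := by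
      refine Alc.pt_injective ?_
      rw [← hκ, hths, cen_one]
      ext <;> simp [Alc.pt, Alc.X, Alc.Y, fw1, fw2] <;> ring
    rw [this]
    constructor <;> simp

end Action

namespace Alc

theorem topZ_of_bounds {x y z : Alc} {m : ℤ} (hx : Dom x) (hm : m = min (y.X - x.X) (2 * x.Y - x.X + 3))
    (hY : z.Y = x.Y) (h0 : x.X ≤ z.X) (h1 : z.X ≤ x.X + m)
    (ha : 2 * (x.X + m) - x.Y ≤ 3 * z.a) : TopZ x y z := by
  have := x.he
  have := y.he
  have := z.he
  refine ⟨?_, hY, h0, by omega, ?_⟩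
  · simp only [Dom, InF, c, X, Y] at *; omega
  · intro p h2 h3 h4 h5
    have := p.he
    simp only [Dom, InF, c, X, Y] at *; omega

theorem botZ_of_bounds {x y z : Alc} {m : ℤ} (hx : Dom x) (hy : Dom y)
    (hm : m = min (2 * (y.X - x.X)) (2 * y.X - y.Y + 3))
    (hY : z.Y = y.Y) (h0 : z.X ≤ y.X) (h1 : 2 * (y.X - z.X) ≤ m)
    (ha : 3 * z.a - 3 ≤ 2 * y.X - y.Y - m) (hb : 2 * (2 * y.Y - y.X) + m ≤ 6 * z.b) :
    BotZ x y z := by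
  have := x.he
  have := y.he
  have := z.he
  refine ⟨?_, hY, by omega, h0, ?_⟩
  · simp only [Dom, InF, c, X, Y] at *; omega
  · intro p h2 h3 h4 h5
    have := p.he
    simp only [Dom, InF, c, X, Y] at *; omega

/-- The polygon spanned by the barycenters of two alcoves. -/
def polygon (u v : Alc) : Set E2 :=
  {p | p ∈ Fid ∧ ((u.X : ℝ) / 3 ≤ p.1 ∧ (u.Y : ℝ) / 3 ≤ p.2) ∧
    p.1 ≤ (v.X : ℝ) / 3 ∧ p.2 ≤ (v.Y : ℝ) / 3}

theorem swap_mem_polygon {u v : Alc} {p : E2} :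
    p.swap ∈ polygon u.swap v.swap ↔ p ∈ polygon u v := by
  simp only [polygon, Fid, B2, a1, a2, rho2, Set.mem_ofPred_eq, swap_X, swap_Y, Prod.fst_swap,
    Prod.snd_swap]
  ring_nf
  tauto

theorem pt_swap (u : Alc) : u.swap.pt = u.pt.swap := by
  simp [pt, swap_X, swap_Y]

theorem Dom.bounds {u : Alc} (h : Dom u) :
    0 ≤ 2 * u.X - u.Y ∧ 0 ≤ 2 * u.Y - u.X ∧ 0 ≤ u.X ∧ 0 ≤ u.Y := by
  have := u.he
  simp only [Dom, X, Y] at *; omega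

variable {x y z : Alc}

theorem up_mem_polygon_iff {m : ℤ} (hx : Dom x) (hY : x.Y ≤ y.Y)
    (hm : m = min (y.X - x.X) (2 * x.Y - x.X + 3)) :
    {t : ℝ | 0 ≤ t ∧ x.pt + t • a1 ∈ polygon x y} = Set.Icc 0 (m / 3 : ℝ) := by
  ext t
  have hm' : t ≤ (m : ℝ) / 3 ↔ t * 3 ≤ ((y.X - x.X : ℤ) : ℝ) ∧
      t * 3 ≤ ((2 * x.Y - x.X + 3 : ℤ) : ℝ) := by
    rw [le_div_iff₀ (by norm_num), hm, Int.cast_min, le_min_iff]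
  obtain ⟨d1, d2, d3, d4⟩ := hx.bounds
  rw [Set.mem_Icc, hm']
  rify at *
  simp only [polygon, pt, Fid, B2, a1, a2, rho2, Set.mem_ofPred_eq, Prod.fst_add, Prod.snd_add,
    Prod.smul_fst, Prod.smul_snd, smul_eq_mul]
  constructor
  · rintro ⟨h, ⟨h1, h2, h3⟩, ⟨h4, h5⟩, h6, h7⟩
    refine ⟨h, ?_, ?_⟩ <;> linarith
  · rintro ⟨h, h1, h2⟩
    refine ⟨h, ⟨?_, ?_, ?_⟩, ⟨?_, ?_⟩, ?_, ?_⟩ <;> linarith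

theorem down_mem_polygon_iff {m : ℤ} (hy : Dom y) (hY : x.Y ≤ y.Y)
    (hm : m = min (2 * (y.X - x.X)) (2 * y.X - y.Y + 3)) :
    {t : ℝ | 0 ≤ t ∧ y.pt - t • a1 ∈ polygon x y} = Set.Icc 0 (m / 6 : ℝ) := by
  ext t
  have hm' : t ≤ (m : ℝ) / 6 ↔ t * 6 ≤ ((2 * (y.X - x.X) : ℤ) : ℝ) ∧
      t * 6 ≤ ((2 * y.X - y.Y + 3 : ℤ) : ℝ) := by
    rw [le_div_iff₀ (by norm_num), hm, Int.cast_min, le_min_iff]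
  obtain ⟨d1, d2, d3, d4⟩ := hy.bounds
  rw [Set.mem_Icc, hm']
  rify at *
  simp only [polygon, pt, Fid, B2, a1, a2, rho2, Set.mem_ofPred_eq, Prod.fst_sub, Prod.snd_sub,
    Prod.smul_fst, Prod.smul_snd, smul_eq_mul]
  constructor
  · rintro ⟨h, ⟨h1, h2, h3⟩, ⟨h4, h5⟩, h6, h7⟩
    refine ⟨h, ?_, ?_⟩ <;> linarith
  · rintro ⟨h, h1, h2⟩
    refine ⟨h, ⟨?_, ?_, ?_⟩, ⟨?_, ?_⟩, ?_, ?_⟩ <;> linarith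

theorem swap_mem_closedAlcove {u : Alc} {p : E2} :
    p.swap ∈ u.swap.closedAlcove ↔ p ∈ u.closedAlcove := by
  simp only [closedAlcove, B2, a1, a2, rho2, Set.mem_ofPred_eq, swap, c, Prod.fst_swap,
    Prod.snd_swap]
  ring_nf
  tauto

/-- The last point of the polygon on the ray from the barycenter of `x` in the direction `r`. -/
noncomputable def upPt (x y : Alc) (r : E2) : E2 :=
  x.pt + sSup {t : ℝ | 0 ≤ t ∧ x.pt + t • r ∈ polygon x y} • r

/-- The last point of the polygon on the ray from the barycenter of `y` in the direction `-r`. -/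
noncomputable def downPt (x y : Alc) (r : E2) : E2 :=
  y.pt - sSup {t : ℝ | 0 ≤ t ∧ y.pt - t • r ∈ polygon x y} • r

theorem topZ_of_segment (hx : Dom x) (hX : x.X ≤ y.X) (hY : x.Y ≤ y.Y)
    (hs : z.pt ∈ segment ℝ x.pt (upPt x y a1)) (hc : upPt x y a1 ∈ z.closedAlcove) :
    TopZ x y z := by
  obtain ⟨m, hm⟩ : ∃ m, m = min (y.X - x.X) (2 * x.Y - x.X + 3) := ⟨_, rfl⟩
  have h0 : 0 ≤ m := by have := hx.bounds; omega
  have hm0 : (0 : ℝ) ≤ m / 3 := by positivity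
  rw [upPt, up_mem_polygon_iff hx hY hm, csSup_Icc hm0] at hs hc
  obtain ⟨p, q, hp, hq, hpq, he⟩ := hs
  obtain rfl : p = 1 - q := by linarith
  simp [Prod.ext_iff, pt, a1] at he
  obtain ⟨e1, e2⟩ := he
  obtain ⟨⟨-, c2⟩, -⟩ := hc
  simp [pt, B2, a1] at c2
  refine topZ_of_bounds hx hm ?_ ?_ ?_ ?_ <;> rify
  · linarith
  · linarith [mul_nonneg hq hm0]
  · linarith [mul_nonneg hp hm0]
  · linarith

theorem botZ_of_segment (hx : Dom x) (hy : Dom y) (hX : x.X ≤ y.X) (hY : x.Y ≤ y.Y)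
    (hs : z.pt ∈ segment ℝ (downPt x y a1) y.pt) (hc : downPt x y a1 ∈ z.closedAlcove) :
    BotZ x y z := by
  obtain ⟨m, hm⟩ : ∃ m, m = min (2 * (y.X - x.X)) (2 * y.X - y.Y + 3) := ⟨_, rfl⟩
  have h0 : 0 ≤ m := by have := hy.bounds; omega
  have hm0 : (0 : ℝ) ≤ m / 6 := by positivity
  rw [downPt, down_mem_polygon_iff hy hY hm, csSup_Icc hm0] at hs hc
  obtain ⟨p, q, hp, hq, hpq, he⟩ := hs
  obtain rfl : p = 1 - q := by linarith
  simp [Prod.ext_iff, pt, a1] at he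
  obtain ⟨e1, e2⟩ := he
  obtain ⟨⟨c1, -⟩, ⟨-, c4⟩, -⟩ := hc
  simp [pt, B2, a1, a2] at c1 c4
  refine botZ_of_bounds hx hy hm ?_ ?_ ?_ ?_ ?_ <;> rify
  · linarith
  · linarith [mul_nonneg hp hm0]
  · linarith [mul_nonneg hq hm0]
  · linarith
  · linarith

theorem swap_smul_a2 (t : ℝ) : (t • a2 : E2).swap = t • a1 := by simp [a1, a2]

theorem swap_upPt : (upPt x y a2).swap = upPt x.swap y.swap a1 := by
  simp only [upPt, Prod.swap_add, swap_smul_a2, pt_swap]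
  simp only [← swap_mem_polygon (u := x), Prod.swap_add, swap_smul_a2]

theorem swap_downPt : (downPt x y a2).swap = downPt x.swap y.swap a1 := by
  simp only [downPt, Prod.swap_sub, swap_smul_a2, pt_swap]
  simp only [← swap_mem_polygon (u := x), Prod.swap_sub, swap_smul_a2]

theorem swap_mem_segment {p q r : E2} (h : r ∈ segment ℝ p q) :
    r.swap ∈ segment ℝ p.swap q.swap := by
  obtain ⟨s, t, hs, ht, hst, rfl⟩ := h
  exact ⟨s, t, hs, ht, hst, by simp⟩

theorem topZ_swap_of_segment (hx : Dom x) (hX : x.X ≤ y.X) (hY : x.Y ≤ y.Y)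
    (hs : z.pt ∈ segment ℝ x.pt (upPt x y a2)) (hc : upPt x y a2 ∈ z.closedAlcove) :
    TopZ x.swap y.swap z.swap := by
  have hs := swap_mem_segment hs
  rw [swap_upPt, ← pt_swap, ← pt_swap] at hs
  rw [← swap_mem_closedAlcove, swap_upPt] at hc
  exact topZ_of_segment (x := x.swap) hx.symm (by rwa [swap_X, swap_X]) (by rwa [swap_Y, swap_Y])
    hs hc

theorem botZ_swap_of_segment (hx : Dom x) (hy : Dom y) (hX : x.X ≤ y.X) (hY : x.Y ≤ y.Y)
    (hs : z.pt ∈ segment ℝ (downPt x y a2) y.pt) (hc : downPt x y a2 ∈ z.closedAlcove) :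
    BotZ x.swap y.swap z.swap := by
  have hs := swap_mem_segment hs
  rw [swap_downPt, ← pt_swap, ← pt_swap] at hs
  rw [← swap_mem_closedAlcove, swap_downPt] at hc
  exact botZ_of_segment (x := x.swap) (y := y.swap) hx.symm hy.symm (by rwa [swap_X, swap_X])
    (by rwa [swap_Y, swap_Y]) hs hc

end Alc

section Geometry

variable {W : Type*} [Group W] {act : W →* Equiv.Perm E2} {κ : W → Alc}

theorem pgn_eq (hκ : ∀ w, cen act w = (κ w).pt) (x y : W) :
    Pgn act x y = (κ x).polygon (κ y) := by
  ext v
  unfold Pgn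
  rw [hκ, hκ]
  refine and_congr_right fun _ => and_congr ⟨?_, fun h => ?_⟩ ⟨?_, fun h => ?_⟩
  · rintro ⟨_, ⟨a, b, ha, hb, rfl⟩, rfl⟩
    simp [Alc.pt, a1, a2, ha, hb]
  · exact ⟨_, ⟨v.1 - (κ x).X / 3, v.2 - (κ x).Y / 3, sub_nonneg.2 h.1, sub_nonneg.2 h.2, rfl⟩,
      by ext <;> simp [Alc.pt, a1, a2]⟩
  · rintro ⟨_, ⟨a, b, ha, hb, rfl⟩, rfl⟩
    simp [Alc.pt, a1, a2, ha, hb]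
  · exact ⟨_, ⟨(κ y).X / 3 - v.1, (κ y).Y / 3 - v.2, sub_nonneg.2 h.1, sub_nonneg.2 h.2, rfl⟩,
      by ext <;> simp [Alc.pt, a1, a2]⟩

theorem vXpt_eq (hκ : ∀ w, cen act w = (κ w).pt) (x y : W) (r : E2) :
    vXpt act x y r = (κ x).upPt (κ y) r := by
  rw [vXpt, pgn_eq hκ, hκ, Alc.upPt]

theorem vYpt_eq (hκ : ∀ w, cen act w = (κ w).pt) (x y : W) (r : E2) :
    vYpt act x y r = (κ x).downPt (κ y) r := by
  rw [vYpt, pgn_eq hκ, hκ, Alc.downPt]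

end Geometry

namespace Alc

variable {x y x' y' z₁ z₂ : Alc}

theorem cle_iff {u v : Alc} : Relation.ReflTransGen Cov u v ↔ Le u v :=
  ⟨le_of_cle, cle_of_le⟩

theorem flip_le_iff {u v : Alc} : Relation.ReflTransGen (flip Cov) u v ↔ Le v u :=
  flip_cle_iff.trans cle_iff

theorem dih_swap {z : Alc} (h : Dih Cov x.swap z.swap) : Dih Cov x z := by
  obtain ⟨⟨w₁, w₂, w₃, w₄, h1, h2, h3, h4, h5⟩, hat⟩ := h
  refine ⟨⟨w₁.swap, w₂.swap, w₃.swap, w₄.swap, cov_swap h1, cov_swap h2, cov_swap h3,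
    cov_swap h4, cle_swap h5⟩, fun c₁ c₂ c₃ a1 a2 a3 l1 l2 l3 => ?_⟩
  have inj : Function.Injective swap := Function.LeftInverse.injective swap_swap
  rw [← inj.eq_iff, ← inj.eq_iff (a := c₁) (b := c₃), ← inj.eq_iff (a := c₂)]
  exact hat _ _ _ (cov_swap a1) (cov_swap a2) (cov_swap a3) (cle_swap l1) (cle_swap l2)
    (cle_swap l3)

theorem dih_flip_swap {z : Alc} (h : Dih (flip Cov) x.swap z.swap) : Dih (flip Cov) x z := by
  obtain ⟨⟨w₁, w₂, w₃, w₄, h1, h2, h3, h4, h5⟩, hat⟩ := h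
  refine ⟨⟨w₁.swap, w₂.swap, w₃.swap, w₄.swap, cov_swap h1, cov_swap h2, cov_swap h3,
    cov_swap h4, flip_cle_swap h5⟩, fun c₁ c₂ c₃ a1 a2 a3 l1 l2 l3 => ?_⟩
  have inj : Function.Injective swap := Function.LeftInverse.injective swap_swap
  rw [← inj.eq_iff, ← inj.eq_iff (a := c₁) (b := c₃), ← inj.eq_iff (a := c₂)]
  exact hat _ _ _ (cov_swap a1) (cov_swap a2) (cov_swap a3) (flip_cle_swap l1)
    (flip_cle_swap l2) (flip_cle_swap l3)

theorem le_or_le_of_dih (h₁ : TopZ x y z₁) (h₂ : TopZ x.swap y.swap z₂.swap) (hx : Dom x)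
    (hy : Dom y) {d : Alc} (hd : Dih Cov x d) (hdy : Le d y) : Le d z₁ ∨ Le d z₂ := by
  rcases okUp_of_dih hx hd with ⟨hY, hok⟩ | ⟨hX, hok⟩
  · exact Or.inl (h₁.le_of_okUp hy hdy hY hok)
  · exact Or.inr (le_swap (h₂.le_of_okUp (y := y.swap) hy.symm (le_swap hdy)
      (by rwa [swap_Y, swap_Y]) hok))

theorem le_or_le_of_dih_flip (h₁ : BotZ x y z₁) (h₂ : BotZ x.swap y.swap z₂.swap) (hx : Dom x)
    (hy : Dom y) {d : Alc} (hd : Dih (flip Cov) y d) (hxd : Le x d) : Le z₁ d ∨ Le z₂ d := by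
  rcases okDown_of_dih hy hd with ⟨hY, hok⟩ | ⟨hX, hok⟩
  · exact Or.inl (h₁.le_of_okDown hx hxd hY hok)
  · exact Or.inr (le_swap (h₂.le_of_okDown (x := x.swap) hx.symm (le_swap hxd)
      (by rwa [swap_Y, swap_Y]) hok))

variable {I J : Type*} {val : I → Alc} {val' : J → Alc} {i₁ i₂ : I} {j₁ j₂ : J}

theorem map_pair_of_topZ (hinj : Function.Injective val)
    (hval : ∀ u, (∃ i, val i = u) ↔ Le x u ∧ Le u y) (hinj' : Function.Injective val')
    (hval' : ∀ u, (∃ i, val' i = u) ↔ Le x' u ∧ Le u y') (φ : I ≃ J)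
    (hφ : ∀ i j, Le (val i) (val j) ↔ Le (val' (φ i)) (val' (φ j)))
    (hx : Dom x) (hy : Dom y) (hx' : Dom x') (hy' : Dom y')
    (h₁ : TopZ x y (val i₁)) (h₂ : TopZ x.swap y.swap (val i₂).swap)
    (h₁' : TopZ x' y' (val' j₁)) (h₂' : TopZ x'.swap y'.swap (val' j₂).swap)
    (l₁ : x.len + 4 ≤ (val i₁).len) (l₂ : x.len + 4 ≤ (val i₂).len) :
    (φ i₁ = j₁ ∧ φ i₂ = j₂) ∨ (φ i₁ = j₂ ∧ φ i₂ = j₁) := by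
  simp only [← cle_iff] at hval hval' hφ
  refine covLike_cov.map_pair hinj hval hinj' hval' φ hφ (h₁.dih hx l₁)
    (dih_swap (h₂.dih hx.symm (by rwa [swap_len, swap_len]))) ?_ ?_
    (fun d hd => ?_) (fun d hd => ?_) (fun l => h₁'.dih hx' (by omega))
    (fun l => dih_swap (h₂'.dih hx'.symm (by rw [swap_len, swap_len]; omega)))
  · rw [cle_iff]
    exact not_le_of_topZ h₁ h₂ hx (by rintro h; rw [h] at l₁; omega)
  · rw [cle_iff]
    exact fun h => not_le_of_topZ (x := x.swap) (y := y.swap)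
      (z₂ := (val i₁).swap) h₂ h₁ hx.symm
      (by intro h; rw [← swap_len (val i₂), h, swap_len] at l₂; omega) (le_swap h)
  · rw [cle_iff, cle_iff]
    exact le_or_le_of_dih h₁ h₂ hx hy hd (cle_iff.1 ((hval _).1 ⟨d, rfl⟩).2)
  · rw [cle_iff, cle_iff]
    exact le_or_le_of_dih h₁' h₂' hx' hy' hd (cle_iff.1 ((hval' _).1 ⟨d, rfl⟩).2)

theorem map_pair_of_botZ (hinj : Function.Injective val)
    (hval : ∀ u, (∃ i, val i = u) ↔ Le x u ∧ Le u y) (hinj' : Function.Injective val')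
    (hval' : ∀ u, (∃ i, val' i = u) ↔ Le x' u ∧ Le u y') (φ : I ≃ J)
    (hφ : ∀ i j, Le (val i) (val j) ↔ Le (val' (φ i)) (val' (φ j)))
    (hx : Dom x) (hy : Dom y) (hx' : Dom x') (hy' : Dom y')
    (h₁ : BotZ x y (val i₁)) (h₂ : BotZ x.swap y.swap (val i₂).swap)
    (h₁' : BotZ x' y' (val' j₁)) (h₂' : BotZ x'.swap y'.swap (val' j₂).swap)
    (l₁ : (val i₁).len + 4 ≤ y.len) (l₂ : (val i₂).len + 4 ≤ y.len) :
    (φ i₁ = j₁ ∧ φ i₂ = j₂) ∨ (φ i₁ = j₂ ∧ φ i₂ = j₁) := by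
  simp only [← flip_le_iff] at hval hval' hφ
  refine covLike_flip.map_pair (x := y) (y := x) (x' := y') (y' := x') hinj
    (fun u => (hval u).trans and_comm) hinj' (fun u => (hval' u).trans and_comm) φ
    (fun i j => hφ j i) (h₁.dih hy l₁)
    (dih_flip_swap (h₂.dih hy.symm (by rwa [swap_len, swap_len]))) ?_ ?_
    (fun d hd => ?_) (fun d hd => ?_) (fun l => h₁'.dih hy' (by omega))
    (fun l => dih_flip_swap (h₂'.dih hy'.symm (by rw [swap_len, swap_len]; omega)))
  · rw [flip_le_iff]
    exact not_le_of_botZ h₁ h₂ hy (by rintro h; rw [h] at l₁; omega)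
  · rw [flip_le_iff]
    exact fun h => not_le_of_botZ (x := x.swap) (y := y.swap)
      (z₂ := (val i₁).swap) h₂ h₁ hy.symm
      (by intro h; rw [← swap_len (val i₂), h, swap_len] at l₂; omega) (le_swap h)
  · rw [flip_le_iff, flip_le_iff]
    exact le_or_le_of_dih_flip h₁ h₂ hx hy hd (flip_le_iff.1 ((hval _).1 ⟨d, rfl⟩).1)
  · rw [flip_le_iff, flip_le_iff]
    exact le_or_le_of_dih_flip h₁' h₂' hx' hy' hd (flip_le_iff.1 ((hval' _).1 ⟨d, rfl⟩).1)

end Alc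

section Interval

variable {W : Type*} [Group W] {M : CoxeterMatrix (Fin 3)} {cs : CoxeterSystem M W}
  {act : W →* Equiv.Perm E2} {κ : W → Alc}

theorem AlcCoord.exists_interval_iff (h : AlcCoord cs κ) (x y : W) (u : Alc) :
    (∃ i : {z : W // bruhatLE cs x z ∧ bruhatLE cs z y}, κ i.1 = u) ↔
      Alc.Le (κ x) u ∧ Alc.Le u (κ y) := by
  constructor
  · rintro ⟨⟨z, hz⟩, rfl⟩
    rwa [← h.bruhatLE_iff, ← h.bruhatLE_iff]
  · obtain ⟨z, rfl⟩ := h.surj u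
    rw [← h.bruhatLE_iff, ← h.bruhatLE_iff]
    exact fun hz => ⟨⟨z, hz⟩, rfl⟩

end Interval

/-- a poset isomorphism of full intervals permutes the distinguished
elements `z₁(x), z₂(x)` (resp. `z₁(y), z₂(y)`) provided they are far enough from the
endpoints. -/
theorem statement13
    {W : Type*} [Group W] {M : CoxeterMatrix (Fin 3)} (cs : CoxeterSystem M W)
    (hM : ∀ i j : Fin 3, M i j = if i = j then 1 else 3)
    (act : W →* Equiv.Perm E2)
    (h0 : ∀ v, act (cs.simple 0) v = reflE rho2 (-1) v)
    (h1 : ∀ v, act (cs.simple 1) v = reflE a1 0 v)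
    (h2 : ∀ v, act (cs.simple 2) v = reflE a2 0 v)
    (hcen : Function.Injective (cen act))
    (th ths : ℕ → ℕ → W)
    (hth : ∀ m n : ℕ, cen act (th m n) =
      cen act (cs.simple 1 * cs.simple 2 * cs.simple 1) + (m : ℝ) • fw1 + (n : ℝ) • fw2)
    (hths : ∀ m n : ℕ, cen act (ths m n) =
      cen act 1 + ((m : ℝ) + 1) • fw1 + ((n : ℝ) + 1) • fw2)
    (x y x' y' : W) (hx : x ∈ Dset th ths) (hy : y ∈ Dset th ths)
    (hx' : x' ∈ Dset th ths) (hy' : y' ∈ Dset th ths)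
    (hxy : bruhatLE cs x y) (hxy' : bruhatLE cs x' y')
    (hfull : FullInt cs x y) (hfull' : FullInt cs x' y')
    (phi : {z : W // bruhatLE cs x z ∧ bruhatLE cs z y} ≃
           {z : W // bruhatLE cs x' z ∧ bruhatLE cs z y'})
    (hphi : ∀ u v, bruhatLE cs u.1 v.1 ↔ bruhatLE cs (phi u).1 (phi v).1) :
    (∀ z1 z2 z1' z2' : W,
      IsZx act x y z1 a1 → IsZx act x y z2 a2 →
      IsZx act x' y' z1' a1 → IsZx act x' y' z2' a2 →
      cs.length x + 4 ≤ cs.length z1 → cs.length x + 4 ≤ cs.length z2 →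
      ∀ (h1 : bruhatLE cs x z1 ∧ bruhatLE cs z1 y)
        (h2 : bruhatLE cs x z2 ∧ bruhatLE cs z2 y),
        ({(phi ⟨z1, h1⟩).1, (phi ⟨z2, h2⟩).1} : Set W) = {z1', z2'}) ∧
    (∀ z1 z2 z1' z2' : W,
      IsZy act x y z1 a1 → IsZy act x y z2 a2 →
      IsZy act x' y' z1' a1 → IsZy act x' y' z2' a2 →
      cs.length z1 + 4 ≤ cs.length y → cs.length z2 + 4 ≤ cs.length y →
      ∀ (h1 : bruhatLE cs x z1 ∧ bruhatLE cs z1 y)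
        (h2 : bruhatLE cs x z2 ∧ bruhatLE cs z2 y),
        ({(phi ⟨z1, h1⟩).1, (phi ⟨z2, h2⟩).1} : Set W) = {z1', z2'}) := by
  have ha : IsAffineAction cs act := ⟨h0, h1, h2⟩
  obtain ⟨κ, hc, hκ, hcl⟩ := ha.exists_coord hcen
  have hinj : ∀ u v : W, Function.Injective
      fun i : {z : W // bruhatLE cs u z ∧ bruhatLE cs z v} => κ i.1 :=
    fun _ _ => hc.inj.comp Subtype.val_injective
  have dom : ∀ {w}, w ∈ Dset th ths → (κ w).Dom := ha.dom hκ hth hths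
  have hle := (hc.bruhatLE_iff _ _).1 hxy
  have hle' := (hc.bruhatLE_iff _ _).1 hxy'
  have top₁ : ∀ {u v z}, u ∈ Dset th ths → v ∈ Dset th ths → (κ u).Le (κ v) →
      IsZx act u v z a1 → (κ u).TopZ (κ v) (κ z) := by
    intro u v z hu hv huv hz
    rw [IsZx, vXpt_eq hκ, hκ, hκ] at hz
    exact Alc.topZ_of_segment (dom hu) (Alc.X_le_X_of_le (dom hv) huv)
      (Alc.Y_le_Y_of_le (dom hv) huv) hz.1 (hcl _ hz.2)
  have top₂ : ∀ {u v z}, u ∈ Dset th ths → v ∈ Dset th ths → (κ u).Le (κ v) →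
      IsZx act u v z a2 → (κ u).swap.TopZ (κ v).swap (κ z).swap := by
    intro u v z hu hv huv hz
    rw [IsZx, vXpt_eq hκ, hκ, hκ] at hz
    exact Alc.topZ_swap_of_segment (dom hu) (Alc.X_le_X_of_le (dom hv) huv)
      (Alc.Y_le_Y_of_le (dom hv) huv) hz.1 (hcl _ hz.2)
  have bot₁ : ∀ {u v z}, u ∈ Dset th ths → v ∈ Dset th ths → (κ u).Le (κ v) →
      IsZy act u v z a1 → (κ u).BotZ (κ v) (κ z) := by
    intro u v z hu hv huv hz
    rw [IsZy, vYpt_eq hκ, hκ, hκ] at hz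
    exact Alc.botZ_of_segment (dom hu) (dom hv) (Alc.X_le_X_of_le (dom hv) huv)
      (Alc.Y_le_Y_of_le (dom hv) huv) hz.1 (hcl _ hz.2)
  have bot₂ : ∀ {u v z}, u ∈ Dset th ths → v ∈ Dset th ths → (κ u).Le (κ v) →
      IsZy act u v z a2 → (κ u).swap.BotZ (κ v).swap (κ z).swap := by
    intro u v z hu hv huv hz
    rw [IsZy, vYpt_eq hκ, hκ, hκ] at hz
    exact Alc.botZ_swap_of_segment (dom hu) (dom hv) (Alc.X_le_X_of_le (dom hv) huv)
      (Alc.Y_le_Y_of_le (dom hv) huv) hz.1 (hcl _ hz.2)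
  have swap_le : ∀ {u v : Alc}, u.swap.Le v.swap → u.Le v := fun h => Alc.le_swap h
  simp only [hc.bruhatLE_iff] at hphi
  have pair : ∀ {a b : {z : W // bruhatLE cs x' z ∧ bruhatLE cs z y'}} {c d : W}
      {hc' : bruhatLE cs x' c ∧ bruhatLE cs c y'} {hd' : bruhatLE cs x' d ∧ bruhatLE cs d y'},
      (a = ⟨c, hc'⟩ ∧ b = ⟨d, hd'⟩) ∨ (a = ⟨d, hd'⟩ ∧ b = ⟨c, hc'⟩) →
      ({a.1, b.1} : Set W) = {c, d} := by
    rintro a b c d _ _ (⟨rfl, rfl⟩ | ⟨rfl, rfl⟩)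
    · rfl
    · exact Set.pair_comm _ _
  have mem : ∀ {z}, (κ x').Le (κ z) ∧ (κ z).Le (κ y') →
      bruhatLE cs x' z ∧ bruhatLE cs z y' := by
    intro z hz
    rwa [hc.bruhatLE_iff, hc.bruhatLE_iff]
  simp only [hc.length_eq]
  refine ⟨fun z₁ z₂ z₁' z₂' hz₁ hz₂ hz₁' hz₂' l₁ l₂ m₁ m₂ => ?_,
    fun z₁ z₂ z₁' z₂' hz₁ hz₂ hz₁' hz₂' l₁ l₂ m₁ m₂ => ?_⟩
  · have t₁ := top₁ hx' hy' hle' hz₁'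
    have t₂ := top₂ hx' hy' hle' hz₂'
    exact pair (hc' := mem (t₁.le (dom hx') (dom hy') hle'))
      (hd' := mem ((t₂.le (dom hx').symm (dom hy').symm (Alc.le_swap hle')).imp swap_le swap_le))
      (Alc.map_pair_of_topZ (hinj x y) (hc.exists_interval_iff x y) (hinj x' y')
        (hc.exists_interval_iff x' y') phi hphi (dom hx) (dom hy) (dom hx') (dom hy')
        (top₁ hx hy hle hz₁) (top₂ hx hy hle hz₂) t₁ t₂ l₁ l₂)
  · have t₁ := bot₁ hx' hy' hle' hz₁'
    have t₂ := bot₂ hx' hy' hle' hz₂'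
    exact pair (hc' := mem (t₁.le (dom hx') (dom hy') hle'))
      (hd' := mem ((t₂.le (dom hx').symm (dom hy').symm (Alc.le_swap hle')).imp swap_le swap_le))
      (Alc.map_pair_of_botZ (hinj x y) (hc.exists_interval_iff x y) (hinj x' y')
        (hc.exists_interval_iff x' y') phi hphi (dom hx) (dom hy) (dom hx') (dom hy')
        (bot₁ hx hy hle hz₁) (bot₂ hx hy hle hz₂) t₁ t₂ l₁ l₂)
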